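/- arXiv:1802.10057 — 4 statements merged into one kernel-verified Lean document; each statement's English description precedes it below -/
import Mathlib

section
/- Let F : [0,∞) × ℝ × ℝ → ℝ be smooth with F(t, x+2π, z) = F(t, x, z) for all t, x, z, and let u₀ : ℝ → ℝ be smooth and 2π-periodic. Then there exist T > 0 and a function u, smooth on [0,T)×ℝ and 2π-periodic in x, such that t·∂_t²u − 2·∂_x∂_t u + ∂_t u = F(t, x, u(t,x)) on [0,T)×ℝ and u(0,x) = u₀(x) for all x. Moreover the solution is unique: if ũ is smooth on [0,T̃)×ℝ, 2π-periodic in x, and solves the same problem, then u = ũ on [0, min(T,T̃))×ℝ. -/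
/-- Partial derivative in the first (time) variable. -/
noncomputable def pt (u : ℝ → ℝ → ℝ) : ℝ → ℝ → ℝ := fun t x => deriv (fun s => u s x) t

/-- Partial derivative in the second (space) variable. -/
noncomputable def px (u : ℝ → ℝ → ℝ) : ℝ → ℝ → ℝ := fun t x => deriv (fun y => u t y) x

/-- Smooth up to the boundary `t = 0`, modelled as the restriction of a smooth
function on `ℝ²`. -/
def Smooth2 (u : ℝ → ℝ → ℝ) : Prop := ContDiff ℝ (⊤ : ℕ∞) (fun p : ℝ × ℝ => u p.1 p.2)

/-- `2π`-periodicity in the second variable. -/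
def Periodic2 (u : ℝ → ℝ → ℝ) : Prop := ∀ t x : ℝ, u t (x + 2 * Real.pi) = u t x

/-- The d'Alembert operator of the Misner metric: `□u = t·∂ₜ²u − 2·∂ₓ∂ₜu + ∂ₜu`. -/
noncomputable def MisnerBox (u : ℝ → ℝ → ℝ) : ℝ → ℝ → ℝ := fun t x =>
  t * pt (pt u) t x - 2 * px (pt u) t x + pt u t x

open scoped BoundedContinuousFunction ContDiff Topology

section Nemytskii

variable {K : Type*} [TopologicalSpace K] {E : Type} [NormedAddCommGroup E] [NormedSpace ℝ E]
  {G : Type} [NormedAddCommGroup G] [NormedSpace ℝ G]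

/-- Smooth maps all of whose derivatives, including the zeroth, are bounded. -/
def BddDerivs (F : E → G) : Prop :=
  ContDiff ℝ ∞ F ∧ ∀ n : ℕ, ∃ C, ∀ p, ‖iteratedFDeriv ℝ n F p‖ ≤ C

theorem BddDerivs.bdd {F : E → G} (hF : BddDerivs F) : ∃ C, 0 ≤ C ∧ ∀ p, ‖F p‖ ≤ C := by
  obtain ⟨C, hC⟩ := hF.2 0
  simp only [norm_iteratedFDeriv_zero] at hC
  exact ⟨C, (norm_nonneg _).trans (hC 0), hC⟩

theorem BddDerivs.fderiv {F : E → G} (hF : BddDerivs F) : BddDerivs (fderiv ℝ F) := by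
  refine ⟨hF.1.fderiv_right (m := ∞) le_rfl, fun n => ?_⟩
  obtain ⟨C, hC⟩ := hF.2 (n + 1)
  exact ⟨C, fun p => by rw [norm_iteratedFDeriv_fderiv]; exact hC p⟩

theorem BddDerivs.lipschitz {F : E → G} (hF : BddDerivs F) :
    ∃ C, 0 ≤ C ∧ ∀ p q, ‖F p - F q‖ ≤ C * ‖p - q‖ := by
  obtain ⟨C, hC0, hC⟩ := hF.fderiv.bdd
  refine ⟨C, hC0, fun p q => ?_⟩
  exact convex_univ.norm_image_sub_le_of_norm_fderiv_le
    (fun x _ => (hF.1.differentiable (by simp)).differentiableAt) (fun x _ => hC x)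
    (Set.mem_univ q) (Set.mem_univ p)

theorem BddDerivs.taylor {F : E → G} (hF : BddDerivs F) :
    ∃ C, 0 ≤ C ∧ ∀ p h, ‖F (p + h) - F p - _root_.fderiv ℝ F p h‖ ≤ C * ‖h‖ * ‖h‖ := by
  obtain ⟨C, hC0, hC⟩ := hF.fderiv.lipschitz
  refine ⟨C, hC0, fun p h => ?_⟩
  have := (convex_segment (𝕜 := ℝ) p (p + h)).norm_image_sub_le_of_norm_fderiv_le' (f := F)
    (φ := _root_.fderiv ℝ F p) (C := C * ‖h‖) (x := p) (y := p + h)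
    (fun x _ => (hF.1.differentiable (by simp)).differentiableAt)
    (fun x hx => (hC x p).trans (mul_le_mul_of_nonneg_left ?_ hC0))
    (left_mem_segment ℝ _ _) (right_mem_segment ℝ _ _)
  · simpa using this
  · have := norm_sub_le_of_mem_segment hx
    simpa using this

/-- The superposition operator `g ↦ F ∘ (b + g)` on bounded continuous functions. -/
noncomputable def nemytskii (b : C(K, E)) {F : E → G} (hF : BddDerivs F) (g : K →ᵇ E) : K →ᵇ G :=
  BoundedContinuousFunction.ofNormedAddCommGroup (fun k => F (b k + g k))
    (hF.1.continuous.comp (b.continuous.add g.continuous)) hF.bdd.choose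
    (fun _ => hF.bdd.choose_spec.2 _)

@[simp]
theorem nemytskii_apply (b : C(K, E)) {F : E → G} (hF : BddDerivs F) (g : K →ᵇ E) (k : K) :
    nemytskii b hF g k = F (b k + g k) := rfl

variable (K E G) in
/-- Pointwise application of a field of linear maps to a vector field. -/
noncomputable def pointwiseApply : (K →ᵇ (E →L[ℝ] G)) →L[ℝ] (K →ᵇ E) →L[ℝ] (K →ᵇ G) :=
  LinearMap.mkContinuous₂
    (LinearMap.mk₂ ℝ (fun (L : K →ᵇ (E →L[ℝ] G)) (g : K →ᵇ E) =>
      BoundedContinuousFunction.ofNormedAddCommGroup (fun k => L k (g k))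
        (L.continuous.clm_apply g.continuous) (‖L‖ * ‖g‖) (fun k =>
          ((L k).le_opNorm _).trans (mul_le_mul (L.norm_coe_le_norm k) (g.norm_coe_le_norm k)
            (norm_nonneg (g k)) (norm_nonneg L))))
      (fun _ _ _ => by ext; simp) (fun _ _ _ => by ext; simp) (fun _ _ _ => by ext; simp)
      (fun _ _ _ => by ext; simp)) 1
    (fun L g => by
      rw [one_mul]
      exact (BoundedContinuousFunction.norm_le (mul_nonneg (norm_nonneg L) (norm_nonneg g))).2
        fun k => ((L k).le_opNorm _).trans (mul_le_mul (L.norm_coe_le_norm k)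
          (g.norm_coe_le_norm k) (norm_nonneg (g k)) (norm_nonneg L)))

@[simp]
theorem pointwiseApply_apply (L : K →ᵇ (E →L[ℝ] G)) (g : K →ᵇ E) (k : K) :
    pointwiseApply K E G L g k = L k (g k) := rfl

theorem hasFDerivAt_nemytskii (b : C(K, E)) {F : E → G} (hF : BddDerivs F) (g : K →ᵇ E) :
    HasFDerivAt (nemytskii b hF) (pointwiseApply K E G (nemytskii b hF.fderiv g)) g := by
  obtain ⟨C, hC0, hC⟩ := hF.taylor
  rw [hasFDerivAt_iff_isLittleO_nhds_zero]
  refine Asymptotics.IsBigO.trans_isLittleO (g := fun h : K →ᵇ E => ‖h‖ * ‖h‖) ?_ ?_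
  · refine Asymptotics.IsBigO.of_bound C (Filter.Eventually.of_forall fun h => ?_)
    rw [norm_mul, norm_norm]
    refine (BoundedContinuousFunction.norm_le (by positivity)).2 fun k => ?_
    have h1 := hC (b k + g k) (h k)
    have h2 := h.norm_coe_le_norm k
    simp only [BoundedContinuousFunction.coe_sub, Pi.sub_apply, nemytskii_apply,
      BoundedContinuousFunction.coe_add, Pi.add_apply, pointwiseApply_apply, ← add_assoc]
    refine h1.trans ?_
    rw [mul_assoc]
    gcongr
  · have h1 : (fun h : K →ᵇ E => ‖h‖) =o[𝓝 0] (fun _ => (1 : ℝ)) := by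
      rw [Asymptotics.isLittleO_one_iff]
      exact tendsto_norm_zero
    have h2 := h1.mul_isBigO (Asymptotics.isBigO_refl (fun h : K →ᵇ E => ‖h‖) (𝓝 0))
    simp only [one_mul] at h2
    exact h2.trans_isBigO (Asymptotics.isBigO_norm_left.2 (Asymptotics.isBigO_refl _ _))

theorem contDiff_nemytskii_nat (b : C(K, E)) (n : ℕ) :
    ∀ {G : Type} [NormedAddCommGroup G] [NormedSpace ℝ G] {F : E → G} (hF : BddDerivs F),
      ContDiff ℝ n (nemytskii b hF) := by
  induction n with
  | zero =>
    intro G _ _ F hF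
    refine contDiff_zero.2 (continuous_iff_continuousAt.2 fun g => ?_)
    exact (hasFDerivAt_nemytskii b hF g).continuousAt
  | succ n ih =>
    intro G _ _ F hF
    have h : ContDiff ℝ n (fun g => pointwiseApply K E G (nemytskii b hF.fderiv g)) := by
      have h1 : ContDiff ℝ n (pointwiseApply K E G) :=
        ContinuousLinearMap.contDiff (E := K →ᵇ (E →L[ℝ] G)) (F := (K →ᵇ E) →L[ℝ] (K →ᵇ G)) _
      exact h1.comp (ih hF.fderiv)
    exact contDiff_succ_iff_hasFDerivAt.2 ⟨_, h, hasFDerivAt_nemytskii b hF⟩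

theorem contDiff_nemytskii (b : C(K, E)) {F : E → G} (hF : BddDerivs F) :
    ContDiff ℝ ∞ (nemytskii b hF) :=
  contDiff_infty.2 fun n => contDiff_nemytskii_nat b n hF

end Nemytskii

section FixedPoint

variable {E X : Type*} [NormedAddCommGroup E] [NormedSpace ℝ E] [CompleteSpace E]
  [NormedAddCommGroup X] [NormedSpace ℝ X] [CompleteSpace X]

/-- The fixed point of a smooth uniform contraction depends smoothly on the parameter. -/
theorem exists_contDiff_fixedPoint (Φ : E × X → X) (hΦ : ContDiff ℝ ∞ Φ)
    (hL : ∀ p U V, ‖Φ (p, U) - Φ (p, V)‖ ≤ 1 / 2 * ‖U - V‖) :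
    ∃ S : E → X, ContDiff ℝ ∞ S ∧ ∀ p U, Φ (p, U) = U ↔ U = S p := by
  have hlip : ∀ p, LipschitzWith (1 / 2) (fun U => Φ (p, U)) := fun p =>
    LipschitzWith.of_dist_le_mul fun U V => by
      rw [dist_eq_norm, dist_eq_norm]
      simpa using hL p U V
  have hcon : ∀ p, ContractingWith (1 / 2) (fun U => Φ (p, U)) := fun p =>
    ⟨by exact_mod_cast one_half_lt_one, hlip p⟩
  let S : E → X := fun p => ContractingWith.fixedPoint _ (hcon p)
  have hS : ∀ p U, Φ (p, U) = U ↔ U = S p := fun p U =>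
    ⟨fun h => (hcon p).fixedPoint_unique h, fun h => h ▸ (hcon p).fixedPoint_isFixedPt⟩
  refine ⟨S, contDiff_iff_contDiffAt.2 fun p => ?_, hS⟩
  let f : E × X → X := fun q => q.2 - Φ q
  have hf : ContDiffAt ℝ ∞ f (p, S p) := (contDiff_snd.sub hΦ).contDiffAt
  have hd : HasFDerivAt f (ContinuousLinearMap.snd ℝ E X - fderiv ℝ Φ (p, S p)) (p, S p) :=
    hasFDerivAt_snd.sub (hΦ.differentiable (by simp)).differentiableAt.hasFDerivAt
  have hn : ‖fderiv ℝ Φ (p, S p) ∘L .inr ℝ E X‖ < 1 := by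
    have h1 : HasFDerivAt (fun U => Φ (p, U)) (fderiv ℝ Φ (p, S p) ∘L .inr ℝ E X) (S p) :=
      HasFDerivAt.comp (S p) (hΦ.differentiable (by simp)).differentiableAt.hasFDerivAt
        (hasFDerivAt_prodMk_right p (S p))
    refine (h1.le_of_lipschitz (hlip p)).trans_lt ?_
    norm_num
  have hinv : (fderiv ℝ f (p, S p) ∘L .inr ℝ E X).IsInvertible := by
    have h1 : fderiv ℝ f (p, S p) ∘L .inr ℝ E X
        = (Units.oneSub _ hn : (X →L[ℝ] X)ˣ) := by
      rw [hd.fderiv, Units.val_oneSub]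
      ext U
      simp
    rw [h1]
    exact ⟨ContinuousLinearEquiv.unitsEquiv ℝ X (Units.oneSub _ hn), rfl⟩
  refine (hf.contDiffAt_implicitFunction (by simp) hinv).congr_of_eventuallyEq ?_
  filter_upwards [hf.eventually_apply_implicitFunction (by simp) hinv] with q hq
  refine ((hS q _).1 ?_).symm
  have h0 : f (p, S p) = 0 := sub_eq_zero.2 ((hS p _).2 rfl).symm
  rw [h0] at hq
  exact (sub_eq_zero.1 hq).symm

end FixedPoint

section Average

open MeasureTheory

variable {K : Type*} [TopologicalSpace K] [FirstCountableTopology K] [MeasurableSpace K]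
  [BorelSpace K]

/-- Averaging of a bounded continuous function along a one-parameter family of self-maps. -/
noncomputable def flowAverage (φ : ℝ → K → K) (hc : ∀ r, Continuous (φ r))
    (hm : ∀ k, Measurable (fun r => φ r k)) : (K →ᵇ ℝ) →L[ℝ] (K →ᵇ ℝ) :=
  have hi (h : K →ᵇ ℝ) (k : K) : IntervalIntegrable (fun r => h (φ r k)) volume 0 1 :=
    (intervalIntegrable_const (c := ‖h‖)).mono_fun
      (h.continuous.measurable.comp (hm k)).aestronglyMeasurable
      (Filter.Eventually.of_forall fun r => by
        simpa using h.norm_coe_le_norm (φ r k))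
  have hb (h : K →ᵇ ℝ) (k : K) : ‖∫ r in (0 : ℝ)..1, h (φ r k)‖ ≤ ‖h‖ := by
    simpa using intervalIntegral.norm_integral_le_of_norm_le_const (a := 0) (b := 1)
      (f := fun r => h (φ r k)) (fun r _ => h.norm_coe_le_norm (φ r k))
  LinearMap.mkContinuous
    { toFun := fun h => BoundedContinuousFunction.ofNormedAddCommGroup
        (fun k => ∫ r in (0 : ℝ)..1, h (φ r k))
        (intervalIntegral.continuous_of_dominated_interval (bound := fun _ => ‖h‖)
          (fun k => (h.continuous.measurable.comp (hm k)).aestronglyMeasurable)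
          (fun k => Filter.Eventually.of_forall fun r _ => h.norm_coe_le_norm _)
          intervalIntegrable_const
          (Filter.Eventually.of_forall fun r _ => h.continuous.comp (hc r)))
        ‖h‖ (hb h)
      map_add' := fun h h' => by
        ext k
        exact intervalIntegral.integral_add (hi h k) (hi h' k)
      map_smul' := fun c h => by
        ext k
        exact intervalIntegral.integral_const_mul _ _ } 1
    (fun h => by
      rw [one_mul]
      exact BoundedContinuousFunction.norm_ofNormedAddCommGroup_le _ (norm_nonneg _) (hb h))

theorem flowAverage_apply (φ : ℝ → K → K) (hc : ∀ r, Continuous (φ r))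
    (hm : ∀ k, Measurable (fun r => φ r k)) (h : K →ᵇ ℝ) (k : K) :
    flowAverage φ hc hm h k = ∫ r in (0 : ℝ)..1, h (φ r k) := rfl

theorem norm_flowAverage_le (φ : ℝ → K → K) (hc : ∀ r, Continuous (φ r))
    (hm : ∀ k, Measurable (fun r => φ r k)) (h : K →ᵇ ℝ) : ‖flowAverage φ hc hm h‖ ≤ ‖h‖ := by
  refine (BoundedContinuousFunction.norm_le (norm_nonneg h)).2 fun k => ?_
  simpa [flowAverage_apply] using intervalIntegral.norm_integral_le_of_norm_le_const
    (a := 0) (b := 1)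
    (f := fun r => h (φ r k)) (fun r _ => h.norm_coe_le_norm (φ r k))

end Average

section Periodicity

theorem exists_bound_of_periodic {Y G : Type*} [TopologicalSpace Y] [NormedAddCommGroup G]
    {g : ℝ → Y → G} (hg : Continuous (fun q : ℝ × Y => g q.1 q.2)) {c : ℝ} (hc : 0 < c)
    (hp : ∀ x y, g (x + c) y = g x y) {S : Set Y} (hS : IsCompact S) :
    ∃ C, 0 ≤ C ∧ ∀ x, ∀ y ∈ S, ‖g x y‖ ≤ C := by
  obtain ⟨C, hC⟩ := (isCompact_Icc (a := (0 : ℝ)) (b := c)).prod hS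
    |>.exists_bound_of_continuousOn hg.continuousOn
  refine ⟨max C 0, le_max_right _ _, fun x y hy => ?_⟩
  have hper : Function.Periodic g c := fun x => funext fun y => hp x y
  obtain ⟨x', hx', he⟩ := hper.exists_mem_Ico₀ hc x
  rw [he]
  exact (hC (x', y) ⟨⟨hx'.1, hx'.2.le⟩, hy⟩).trans (le_max_left _ _)

theorem BddDerivs.of_periodic {f : ℝ → ℝ} (hf : ContDiff ℝ ∞ f) {c : ℝ} (hc : 0 < c)
    (hp : Function.Periodic f c) : BddDerivs f := by
  refine ⟨hf, fun n => ?_⟩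
  have hcont : Continuous (iteratedFDeriv ℝ n f) :=
    hf.continuous_iteratedFDeriv (by exact_mod_cast le_top)
  have hper : ∀ x, iteratedFDeriv ℝ n f (x + c) = iteratedFDeriv ℝ n f x := fun x => by
    rw [← iteratedFDeriv_comp_add_right]
    congr 1
    exact funext hp
  obtain ⟨C, -, hC⟩ := exists_bound_of_periodic (Y := Unit)
    (g := fun x _ => iteratedFDeriv ℝ n f x) (by fun_prop) hc (fun x _ => hper x) isCompact_univ
  exact ⟨C, fun p => hC p () trivial⟩

/-- A smooth nonlinearity, periodic in space, agrees for bounded time and field values with one all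
of whose derivatives are bounded. -/
theorem exists_bddDerivs_eq {F : ℝ → ℝ → ℝ → ℝ}
    (hF : ContDiff ℝ ∞ (fun p : ℝ × ℝ × ℝ => F p.1 p.2.1 p.2.2)) {c : ℝ} (hc : 0 < c)
    (hp : ∀ t x z : ℝ, F t (x + c) z = F t x z) {R : ℝ} (hR : 0 < R) :
    ∃ H : ℝ × ℝ × ℝ → ℝ, BddDerivs H ∧ (∀ t x z, H (t, x + c, z) = H (t, x, z)) ∧
      ∀ t x z, |t| ≤ R → |z| ≤ R → H (t, x, z) = F t x z := by
  let χ : ContDiffBump (0 : ℝ) := ⟨R, R + 1, hR, by linarith⟩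
  let H : ℝ × ℝ × ℝ → ℝ := fun p => χ p.1 * χ p.2.2 * F p.1 p.2.1 p.2.2
  have hH : ContDiff ℝ ∞ H :=
    ((χ.contDiff.comp contDiff_fst).mul
      (χ.contDiff.comp (contDiff_snd.comp contDiff_snd))).mul hF
  have hHp : ∀ t x z, H (t, x + c, z) = H (t, x, z) := fun t x z => by simp [H, hp]
  refine ⟨H, ⟨hH, fun n => ?_⟩, hHp, fun t x z ht hz => ?_⟩
  · have hcont : Continuous (iteratedFDeriv ℝ n H) :=
      hH.continuous_iteratedFDeriv (by exact_mod_cast le_top)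
    have hper : ∀ p, iteratedFDeriv ℝ n H (p + (0, c, 0)) = iteratedFDeriv ℝ n H p := fun p => by
      rw [← iteratedFDeriv_comp_add_right]
      congr 1
      funext q
      have h : q + (0, c, 0) = (q.1, q.2.1 + c, q.2.2) := by ext <;> simp
      rw [h]
      exact hHp q.1 q.2.1 q.2.2
    obtain ⟨C, hC0, hC⟩ := exists_bound_of_periodic (Y := ℝ × ℝ)
      (g := fun x y => iteratedFDeriv ℝ n H (y.1, x, y.2)) (by fun_prop) hc
      (fun x y => by simpa using hper (y.1, x, y.2))
      ((isCompact_closedBall (0 : ℝ) (R + 1)).prod (isCompact_closedBall (0 : ℝ) (R + 1)))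
    have hsupp : tsupport H ⊆ {p | |p.1| ≤ R + 1 ∧ |p.2.2| ≤ R + 1} := by
      refine closure_minimal (fun p hp => ?_) ?_
      · have h1 : χ p.1 ≠ 0 := fun h => hp (by simp [H, h])
        have h2 : χ p.2.2 ≠ 0 := fun h => hp (by simp [H, h])
        have h3 : ∀ y, χ y ≠ 0 → |y| ≤ R + 1 := fun y hy => by
          by_contra! h
          exact hy (χ.zero_of_le_dist (by simpa [χ] using h.le))
        exact ⟨h3 _ h1, h3 _ h2⟩
      · exact (isClosed_le (f := fun p : ℝ × ℝ × ℝ => |p.1|) (by fun_prop) continuous_const).inter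
          (isClosed_le (f := fun p : ℝ × ℝ × ℝ => |p.2.2|) (by fun_prop) continuous_const)
    refine ⟨C, fun p => ?_⟩
    by_cases hp : p ∈ Function.support (iteratedFDeriv ℝ n H)
    · have := hsupp (support_iteratedFDeriv_subset n hp)
      refine hC p.2.1 (p.1, p.2.2) ⟨?_, ?_⟩
      · simpa using this.1
      · simpa using this.2
    · rw [Function.notMem_support.1 hp, norm_zero]
      exact hC0
  · have h3 : ∀ y, |y| ≤ R → χ y = 1 := fun y hy =>
      χ.one_of_mem_closedBall (by simpa [χ] using hy)
    simp [H, h3 t ht, h3 z hz]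

end Periodicity

section Calculus

variable {u : ℝ → ℝ → ℝ}

theorem Smooth2.hasDerivAt_comp (hu : Smooth2 u) {a b : ℝ → ℝ} {a' b' r : ℝ}
    (ha : HasDerivAt a a' r) (hb : HasDerivAt b b' r) :
    HasDerivAt (fun r => u (a r) (b r)) (a' * pt u (a r) (b r) + b' * px u (a r) (b r)) r := by
  set L := fderiv ℝ (fun p : ℝ × ℝ => u p.1 p.2) (a r, b r)
  have hL : HasFDerivAt (fun p : ℝ × ℝ => u p.1 p.2) L (a r, b r) :=
    (ContDiff.differentiable hu (by simp)).differentiableAt.hasFDerivAt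
  have h1 : pt u (a r) (b r) = L (1, 0) := by
    have := HasFDerivAt.comp_hasDerivAt (a r) (f := fun s => (s, b r)) hL
      ((hasDerivAt_id (a r)).prodMk (hasDerivAt_const (a r) (b r)))
    exact this.deriv
  have h2 : px u (a r) (b r) = L (0, 1) := by
    have := HasFDerivAt.comp_hasDerivAt (b r) (f := fun s => (a r, s)) hL
      ((hasDerivAt_const (b r) (a r)).prodMk (hasDerivAt_id (b r)))
    exact this.deriv
  have h3 := HasFDerivAt.comp_hasDerivAt r (f := fun s => (a s, b s)) hL (ha.prodMk hb)
  have h4 : L (a', b') = a' * pt u (a r) (b r) + b' * px u (a r) (b r) := by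
    rw [h1, h2, ← smul_eq_mul, ← smul_eq_mul, ← map_smul, ← map_smul, ← map_add]
    simp
  rw [← h4]
  exact h3

theorem Smooth2.pt (hu : Smooth2 u) : Smooth2 (pt u) := by
  have h : (fun p : ℝ × ℝ => _root_.pt u p.1 p.2)
      = fun p => fderiv ℝ (fun p : ℝ × ℝ => u p.1 p.2) p (1, 0) := by
    funext p
    have hL : HasFDerivAt (fun p : ℝ × ℝ => u p.1 p.2) _ (p.1, p.2) :=
      (ContDiff.differentiable hu (by simp)).differentiableAt.hasFDerivAt
    have := HasFDerivAt.comp_hasDerivAt p.1 (f := fun s => (s, p.2)) hL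
      ((hasDerivAt_id p.1).prodMk (hasDerivAt_const p.1 p.2))
    exact this.deriv
  rw [Smooth2, h]
  exact (ContDiff.fderiv_right (m := ∞) hu le_rfl).clm_apply contDiff_const

theorem Periodic2.pt (hu : Periodic2 u) : Periodic2 (pt u) := fun t x => by
  have h : (fun s => u s (x + 2 * Real.pi)) = fun s => u s x := funext fun s => hu s x
  show deriv (fun s => u s (x + 2 * Real.pi)) t = deriv (fun s => u s x) t
  rw [h]

theorem Periodic2.exists_bound (hu : Continuous (fun p : ℝ × ℝ => u p.1 p.2)) (hp : Periodic2 u)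
    (R : ℝ) : ∃ C, 0 ≤ C ∧ ∀ t x, |t| ≤ R → |u t x| ≤ C := by
  obtain ⟨C, hC0, hC⟩ := exists_bound_of_periodic (g := fun x t => u t x)
    (hu.comp continuous_swap) Real.two_pi_pos (fun x t => hp t x)
    (isCompact_closedBall (0 : ℝ) R)
  exact ⟨C, hC0, fun t x ht => hC x t (by simpa using ht)⟩

/-- Along the null curves `r ↦ (t r, x - 2 log r)` the Misner wave operator is a total
derivative. -/
theorem Smooth2.hasDerivAt_null_curve (hu : Smooth2 u) (t x : ℝ) {r : ℝ} (hr : 0 < r) :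
    HasDerivAt (fun r => r * _root_.pt u (t * r) (x - 2 * Real.log r))
      (MisnerBox u (t * r) (x - 2 * Real.log r)) r := by
  have ha : HasDerivAt (fun r => t * r) t r := by simpa using (hasDerivAt_id r).const_mul t
  have hb : HasDerivAt (fun r => x - 2 * Real.log r) (-(2 * r⁻¹)) r :=
    ((Real.hasDerivAt_log hr.ne').const_mul 2).const_sub x
  refine ((hasDerivAt_id r).mul (hu.pt.hasDerivAt_comp ha hb)).congr_deriv ?_
  rw [MisnerBox, id]
  field_simp
  ring

end Calculus

section Uniqueness

theorem abs_pt_le_of_abs_misnerBox_le {w g : ℝ → ℝ → ℝ} {t x B D : ℝ}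
    (hg : ∀ r, 0 < r → r ≤ 1 →
      HasDerivAt (fun r => r * w (t * r) (x - 2 * Real.log r))
        (g (t * r) (x - 2 * Real.log r)) r)
    (hD : ∀ r, 0 < r → r ≤ 1 → |w (t * r) (x - 2 * Real.log r)| ≤ D)
    (hB : ∀ r, 0 < r → r ≤ 1 → |g (t * r) (x - 2 * Real.log r)| ≤ B) :
    |w t x| ≤ B := by
  have hB0 : 0 ≤ B := (abs_nonneg _).trans (hB 1 one_pos le_rfl)
  have hD0 : 0 ≤ D := (abs_nonneg _).trans (hD 1 one_pos le_rfl)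
  have key : ∀ ε, 0 < ε → ε ≤ 1 → |w t x| ≤ B + ε * D := fun ε hε hε1 => by
    have h1 := (convex_Icc ε 1).norm_image_sub_le_of_norm_hasDerivWithin_le
      (fun r hr => (hg r (hε.trans_le hr.1) hr.2).hasDerivWithinAt)
      (fun r hr => hB r (hε.trans_le hr.1) hr.2)
      (Set.left_mem_Icc.2 hε1) (Set.right_mem_Icc.2 hε1)
    simp only [Real.log_one, mul_one, mul_zero, sub_zero, one_mul, Real.norm_eq_abs] at h1
    have h2 := abs_sub_abs_le_abs_sub (w t x) (ε * w (t * ε) (x - 2 * Real.log ε))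
    rw [abs_mul, abs_of_pos hε] at h2
    have h3 := mul_le_mul_of_nonneg_left (hD ε hε hε1) hε.le
    have h4 : B * |1 - ε| ≤ B := mul_le_of_le_one_right hB0 (by rw [abs_of_nonneg] <;> linarith)
    linarith
  have hlim : Filter.Tendsto (fun ε : ℝ => B + ε * D) (𝓝[>] 0) (𝓝 B) := by
    have : Filter.Tendsto (fun ε : ℝ => B + ε * D) (𝓝 0) (𝓝 (B + 0 * D)) :=
      (Continuous.tendsto (by fun_prop) 0)
    simpa using this.mono_left nhdsWithin_le_nhds
  refine ge_of_tendsto hlim ?_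
  filter_upwards [Ioc_mem_nhdsGT (zero_lt_one' ℝ)] with ε hε using key ε hε.1 hε.2

theorem misner_unique {F : ℝ → ℝ → ℝ → ℝ}
    (hF : ContDiff ℝ ∞ (fun p : ℝ × ℝ × ℝ => F p.1 p.2.1 p.2.2))
    (hFp : ∀ t x z : ℝ, F t (x + 2 * Real.pi) z = F t x z) {u v : ℝ → ℝ → ℝ}
    (hu : Smooth2 u) (hup : Periodic2 u) (hv : Smooth2 v) (hvp : Periodic2 v) {a : ℝ}
    (hua : ∀ t x : ℝ, 0 ≤ t → t ≤ a → MisnerBox u t x = F t x (u t x))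
    (hva : ∀ t x : ℝ, 0 ≤ t → t ≤ a → MisnerBox v t x = F t x (v t x))
    (h0 : ∀ x, u 0 x = v 0 x) (t x : ℝ) (ht0 : 0 ≤ t) (hta : t ≤ a) : u t x = v t x := by
  obtain ⟨Cu, hCu0, hCu⟩ := hup.exists_bound (ContDiff.continuous hu) a
  obtain ⟨Cv, hCv0, hCv⟩ := hvp.exists_bound (ContDiff.continuous hv) a
  obtain ⟨Du, hDu0, hDu⟩ := hup.pt.exists_bound (ContDiff.continuous hu.pt) a
  obtain ⟨Dv, hDv0, hDv⟩ := hvp.pt.exists_bound (ContDiff.continuous hv.pt) a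
  have ha0 : 0 ≤ a := ht0.trans hta
  obtain ⟨H, hH, -, hHF⟩ := exists_bddDerivs_eq hF Real.two_pi_pos hFp
    (R := a + Cu + Cv + 1) (by linarith)
  obtain ⟨L', hL'0, hL'⟩ := hH.lipschitz
  set L := L' + 1 with hL
  have hLip : ∀ t x, 0 ≤ t → t ≤ a →
      |F t x (u t x) - F t x (v t x)| ≤ L * |u t x - v t x| := fun t x ht0 hta => by
    have hta' : |t| ≤ a := by rwa [abs_of_nonneg ht0]
    have h1 := hCu t x hta'
    have h2 := hCv t x hta'
    rw [← hHF t x (u t x) (by linarith) (by linarith),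
      ← hHF t x (v t x) (by linarith) (by linarith)]
    have h3 := hL' (t, x, u t x) (t, x, v t x)
    have h4 : ‖((t, x, u t x) : ℝ × ℝ × ℝ) - (t, x, v t x)‖ = |u t x - v t x| := by
      simp [Prod.norm_def]
    rw [h4] at h3
    refine h3.trans (mul_le_mul_of_nonneg_right (by linarith) (abs_nonneg _))
  have step : ∀ C, 0 ≤ C →
      (∀ t x, 0 ≤ t → t ≤ a → |u t x - v t x| ≤ C * Real.exp (2 * L * t)) →
      ∀ t x, 0 ≤ t → t ≤ a → |u t x - v t x| ≤ C / 2 * Real.exp (2 * L * t) := by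
    intro C hC0 hC
    have hpt : ∀ t x, 0 ≤ t → t ≤ a →
        |pt u t x - pt v t x| ≤ L * (C * Real.exp (2 * L * t)) := by
      intro t x ht0 hta
      have hr : ∀ r, 0 < r → r ≤ 1 → 0 ≤ t * r ∧ t * r ≤ t ∧ t * r ≤ a ∧ |t * r| ≤ a :=
        fun r hr0 hr1 => by
          have h1 : 0 ≤ t * r := by positivity
          have h2 : t * r ≤ t := mul_le_of_le_one_right ht0 hr1
          exact ⟨h1, h2, h2.trans hta, by rw [abs_of_nonneg h1]; exact h2.trans hta⟩
      refine abs_pt_le_of_abs_misnerBox_le (w := fun t x => pt u t x - pt v t x)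
        (g := fun t x => MisnerBox u t x - MisnerBox v t x) (D := Du + Dv) ?_ ?_ ?_
      · intro r hr0 hr1
        simp only [mul_sub]
        exact (hu.hasDerivAt_null_curve t x hr0).sub (hv.hasDerivAt_null_curve t x hr0)
      · intro r hr0 hr1
        obtain ⟨-, -, -, h⟩ := hr r hr0 hr1
        exact (abs_sub _ _).trans (add_le_add (hDu _ _ h) (hDv _ _ h))
      · intro r hr0 hr1
        obtain ⟨h1, h2, h3, -⟩ := hr r hr0 hr1
        simp only [hua _ _ h1 h3, hva _ _ h1 h3]
        refine (hLip _ _ h1 h3).trans (mul_le_mul_of_nonneg_left ?_ (by linarith))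
        refine (hC _ _ h1 h3).trans (mul_le_mul_of_nonneg_left ?_ hC0)
        exact Real.exp_le_exp.2 (mul_le_mul_of_nonneg_left h2 (by linarith))
    intro t x ht0 hta
    have hd : ∀ {w : ℝ → ℝ → ℝ}, Smooth2 w → ∀ s, HasDerivAt (fun s => w s x) (pt w s x) s :=
      fun hw s => by
        simpa using hw.hasDerivAt_comp (hasDerivAt_id s) (hasDerivAt_const s x)
    have hd' : ∀ s, HasDerivAt (fun s => u s x - v s x) (pt u s x - pt v s x) s :=
      fun s => (hd hu s).sub (hd hv s)
    have hB : ∀ s, HasDerivAt (fun s => C / 2 * Real.exp (2 * L * s))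
        (L * (C * Real.exp (2 * L * s))) s := fun s => by
      have h1 : HasDerivAt (fun s => 2 * L * s) (2 * L) s := by
        simpa using (hasDerivAt_id s).const_mul (2 * L)
      exact (h1.exp.const_mul (C / 2)).congr_deriv (by ring)
    refine image_norm_le_of_norm_deriv_right_le_deriv_boundary (a := 0) (b := a)
      (f := fun s => u s x - v s x)
      (fun s _ => (hd' s).continuousAt.continuousWithinAt)
      (fun s _ => (hd' s).hasDerivWithinAt) ?_ hB
      (fun s hs => hpt s x hs.1 hs.2.le) ⟨ht0, hta⟩
    simp only [h0, sub_self, norm_zero]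
    positivity
  have iter : ∀ n : ℕ, ∀ t x, 0 ≤ t → t ≤ a →
      |u t x - v t x| ≤ (Cu + Cv) * (1 / 2) ^ n * Real.exp (2 * L * t) := by
    intro n
    induction n with
    | zero =>
      intro t x ht0 hta
      have hta' : |t| ≤ a := by rwa [abs_of_nonneg ht0]
      have h1 : (1 : ℝ) ≤ Real.exp (2 * L * t) := Real.one_le_exp (by positivity)
      have h2 := (abs_sub (u t x) (v t x)).trans (add_le_add (hCu t x hta') (hCv t x hta'))
      rw [pow_zero, mul_one]
      exact h2.trans (le_mul_of_one_le_right (by linarith) h1)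
    | succ n ih =>
      intro t x ht0 hta
      convert step _ (by positivity) ih t x ht0 hta using 2
      ring
  have hlim : Filter.Tendsto (fun n : ℕ => (Cu + Cv) * (1 / 2) ^ n * Real.exp (2 * L * t))
      Filter.atTop (𝓝 0) := by
    have := ((tendsto_pow_atTop_nhds_zero_of_lt_one (r := (1 / 2 : ℝ)) (by norm_num)
      (by norm_num)).const_mul (Cu + Cv)).mul_const (Real.exp (2 * L * t))
    simpa using this
  have := ge_of_tendsto' hlim (fun n => iter n t x ht0 hta)
  exact sub_eq_zero.1 (abs_nonpos_iff.1 this)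

end Uniqueness

section Duhamel

open MeasureTheory

theorem intervalIntegral_null_curve_scale (f : ℝ → ℝ → ℝ) (t x : ℝ) {r : ℝ} (hr : 0 < r) :
    r * ∫ ρ in (0 : ℝ)..1, f (t * r * ρ) (x - 2 * Real.log r - 2 * Real.log ρ)
      = ∫ η in (0 : ℝ)..r, f (t * η) (x - 2 * Real.log η) := by
  have h := intervalIntegral.mul_integral_comp_mul_left (a := 0) (b := 1)
    (f := fun η => f (t * η) (x - 2 * Real.log η)) r
  simp only [mul_zero, mul_one] at h
  rw [← h]
  congr 1
  refine intervalIntegral.integral_congr_ae (Filter.Eventually.of_forall fun ρ hρ => ?_)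
  rw [Set.uIoc_of_le zero_le_one] at hρ
  rw [Real.log_mul hr.ne' hρ.1.ne']
  ring_nf

/-- A smooth function given by the Duhamel formula with source `f` solves `□u = f`. -/
theorem misnerBox_eq_of_duhamel {u f : ℝ → ℝ → ℝ} {u₀ : ℝ → ℝ} {T M : ℝ} (hu : Smooth2 u)
    (hf : Continuous (fun p : ℝ × ℝ => f p.1 p.2)) (hM : ∀ t x, |f t x| ≤ M)
    (h : ∀ t x, |t| < T → u t x = u₀ x + t * ∫ σ in (0 : ℝ)..1, ∫ ρ in (0 : ℝ)..1,
      f (t * σ * ρ) (x - 2 * Real.log ρ)) {t : ℝ} (x : ℝ) (ht : |t| < T) :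
    MisnerBox u t x = f t x := by
  have hmeas : ∀ t x, Measurable (fun ρ => f (t * ρ) (x - 2 * Real.log ρ)) := fun t x =>
    hf.measurable.comp ((measurable_const_mul t).prodMk
      ((Real.measurable_log.const_mul 2).const_sub x))
  have hv : ∀ x, Continuous (fun t => ∫ ρ in (0 : ℝ)..1, f (t * ρ) (x - 2 * Real.log ρ)) :=
    fun x => intervalIntegral.continuous_of_dominated_interval (bound := fun _ => M)
      (fun t => (hmeas t x).aestronglyMeasurable)
      (fun t => Filter.Eventually.of_forall fun ρ _ => hM _ _) intervalIntegrable_const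
      (Filter.Eventually.of_forall fun ρ _ =>
        hf.comp (f := fun t : ℝ => (t * ρ, x - 2 * Real.log ρ)) (by fun_prop))
  have hnear : ∀ {t : ℝ}, |t| < T → ∀ᶠ s in 𝓝 t, |s| < T := fun ht =>
    continuous_abs.continuousAt.eventually (gt_mem_nhds ht)
  have hpt : ∀ t x, |t| < T →
      pt u t x = ∫ ρ in (0 : ℝ)..1, f (t * ρ) (x - 2 * Real.log ρ) := fun t x ht => by
    have h1 : HasDerivAt (fun s => u₀ x + ∫ τ in (0 : ℝ)..s, ∫ ρ in (0 : ℝ)..1,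
        f (τ * ρ) (x - 2 * Real.log ρ))
        (∫ ρ in (0 : ℝ)..1, f (t * ρ) (x - 2 * Real.log ρ)) t :=
      ((hv x).integral_hasStrictDerivAt 0 t).hasDerivAt.const_add _
    refine (h1.congr_of_eventuallyEq ?_).deriv
    filter_upwards [hnear ht] with s hs
    have h2 := intervalIntegral.mul_integral_comp_mul_left (a := 0) (b := 1)
      (f := fun τ => ∫ ρ in (0 : ℝ)..1, f (τ * ρ) (x - 2 * Real.log ρ)) s
    simp only [mul_zero, mul_one] at h2
    rw [h s x hs, h2]
  have hcurve := hu.hasDerivAt_null_curve t x one_pos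
  simp only [Real.log_one, mul_one, mul_zero, sub_zero] at hcurve
  have hderivInt : HasDerivAt (fun r => ∫ η in (0 : ℝ)..r, f (t * η) (x - 2 * Real.log η))
      (f (t * 1) (x - 2 * Real.log 1)) 1 := by
    refine intervalIntegral.integral_hasDerivAt_right ?_ ?_ ?_
    · exact (intervalIntegrable_const (c := M)).mono_fun (hmeas t x).aestronglyMeasurable
        (Filter.Eventually.of_forall fun r => (hM _ _).trans (le_abs_self M))
    · exact (hmeas t x).stronglyMeasurable.stronglyMeasurableAtFilter
    · exact hf.continuousAt.comp₂ (by fun_prop)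
        (continuousAt_const.sub ((Real.continuousAt_log one_ne_zero).const_mul 2))
  simp only [Real.log_one, mul_one, mul_zero, sub_zero] at hderivInt
  refine hcurve.unique (hderivInt.congr_of_eventuallyEq ?_)
  have hr : ∀ᶠ r in 𝓝 (1 : ℝ), |t * r| < T := by
    have hc : ContinuousAt (fun r => |t * r|) 1 := by fun_prop
    exact hc.tendsto.eventually (gt_mem_nhds (by simpa using ht))
  filter_upwards [hr, lt_mem_nhds one_pos] with r hr hr0
  rw [hpt _ _ hr, intervalIntegral_null_curve_scale f t x hr0]

end Duhamel

section Existence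

/-- Truncation of a real number to `[0, 1]`. -/
noncomputable def clamp (τ : ℝ) : ℝ := max 0 (min 1 τ)

theorem continuous_clamp : Continuous clamp := by unfold clamp; fun_prop

theorem clamp_nonneg (τ : ℝ) : 0 ≤ clamp τ := le_max_left _ _

theorem clamp_le_one (τ : ℝ) : clamp τ ≤ 1 := max_le zero_le_one (min_le_left _ _)

theorem norm_clamp_le_one (τ : ℝ) : ‖clamp τ‖ ≤ 1 := by
  rw [Real.norm_of_nonneg (clamp_nonneg τ)]
  exact clamp_le_one τ

theorem clamp_of_mem {τ : ℝ} (h0 : 0 ≤ τ) (h1 : τ ≤ 1) : clamp τ = τ := by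
  rw [clamp, min_eq_right h1, max_eq_right h0]

theorem clamp_mul {τ σ : ℝ} (hτ0 : 0 ≤ τ) (hτ1 : τ ≤ 1) (hσ0 : 0 ≤ σ) (hσ1 : σ ≤ 1) :
    clamp (τ * σ) = τ * σ :=
  clamp_of_mem (mul_nonneg hτ0 hσ0) (mul_le_one₀ hτ1 hσ0 hσ1)

/-- Averaging over `σ` along `(τ, y) ↦ (τ σ, y)`. -/
noncomputable def timeAverage : (ℝ × ℝ →ᵇ ℝ) →L[ℝ] (ℝ × ℝ →ᵇ ℝ) :=
  flowAverage (fun σ k => (clamp k.1 * σ, k.2))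
    (fun _ => by have := continuous_clamp; fun_prop) (fun _ => by fun_prop)

/-- Averaging over `ρ` along the null flow `(τ, y) ↦ (τ ρ, y - 2 log ρ)`. -/
noncomputable def nullAverage : (ℝ × ℝ →ᵇ ℝ) →L[ℝ] (ℝ × ℝ →ᵇ ℝ) :=
  flowAverage (fun ρ k => (clamp k.1 * ρ, k.2 - 2 * Real.log ρ))
    (fun _ => by have := continuous_clamp; fun_prop) (fun _ => by fun_prop)

theorem timeAverage_apply (h : ℝ × ℝ →ᵇ ℝ) (k : ℝ × ℝ) :
    timeAverage h k = ∫ σ in (0 : ℝ)..1, h (clamp k.1 * σ, k.2) := rfl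

theorem nullAverage_apply (h : ℝ × ℝ →ᵇ ℝ) (k : ℝ × ℝ) :
    nullAverage h k = ∫ ρ in (0 : ℝ)..1, h (clamp k.1 * ρ, k.2 - 2 * Real.log ρ) := rfl

/-- The function `(τ, y) ↦ clamp τ`. -/
noncomputable def clampFst : ℝ × ℝ →ᵇ ℝ :=
  BoundedContinuousFunction.ofNormedAddCommGroup (fun k => clamp k.1)
    (continuous_clamp.comp continuous_fst) 1 (fun k => norm_clamp_le_one k.1)

@[simp]
theorem clampFst_apply (k : ℝ × ℝ) : clampFst k = clamp k.1 := rfl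

theorem norm_clampFst_le : ‖clampFst‖ ≤ 1 :=
  (BoundedContinuousFunction.norm_le zero_le_one).2 fun k => norm_clamp_le_one k.1

/-- The jet `(τ, y) ↦ (s τ, x, U (τ, y))` as an element of a space of bounded functions. -/
noncomputable def jet (s x : ℝ) (U : ℝ × ℝ →ᵇ ℝ) : ℝ × ℝ →ᵇ ℝ × ℝ × ℝ :=
  s • (ContinuousLinearMap.inl ℝ ℝ (ℝ × ℝ)).compLeftContinuousBounded (ℝ × ℝ) clampFst
    + BoundedContinuousFunction.const (ℝ × ℝ) (0, x, 0)
    + ((ContinuousLinearMap.inr ℝ ℝ (ℝ × ℝ)).comp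
        (ContinuousLinearMap.inr ℝ ℝ ℝ)).compLeftContinuousBounded (ℝ × ℝ) U

theorem jet_apply (s x : ℝ) (U : ℝ × ℝ →ᵇ ℝ) (k : ℝ × ℝ) :
    jet s x U k = (s * clamp k.1, x, U k) := by
  ext <;> simp [jet, ContinuousLinearMap.compLeftContinuousBounded_apply]

variable (K E : Type*) [TopologicalSpace K] [NormedAddCommGroup E] [NormedSpace ℝ E] in
theorem contDiff_boundedConst {n : WithTop ℕ∞} :
    ContDiff ℝ n (BoundedContinuousFunction.const K : E → K →ᵇ E) :=
  (LinearMap.mkContinuous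
    { toFun := BoundedContinuousFunction.const K
      map_add' := fun _ _ => rfl
      map_smul' := fun _ _ => rfl } 1
    (fun b => by rw [one_mul]; exact BoundedContinuousFunction.norm_const_le b)).contDiff

theorem contDiff_jet {φ : ℝ → ℝ} (hφ : ContDiff ℝ ∞ φ) :
    ContDiff ℝ ∞ (fun q : (ℝ × ℝ) × (ℝ × ℝ →ᵇ ℝ) => jet (φ q.1.1) q.1.2 q.2) := by
  refine ContDiff.add (ContDiff.add ?_ ?_) ?_
  · exact (hφ.comp (contDiff_fst.comp contDiff_fst)).smul contDiff_const
  · exact (contDiff_boundedConst (ℝ × ℝ) (ℝ × ℝ × ℝ)).comp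
      (contDiff_const.prodMk ((contDiff_snd.comp contDiff_fst).prodMk contDiff_const))
  · exact (ContinuousLinearMap.contDiff _).comp contDiff_snd

/-- The base field `(τ, y) ↦ (0, y, 0)`. -/
def baseField : C(ℝ × ℝ, ℝ × ℝ × ℝ) := ⟨fun k => (0, k.2, 0), by fun_prop⟩

/-- The second coordinate as a continuous map. -/
def sndField : C(ℝ × ℝ, ℝ) := ⟨fun k => k.2, by fun_prop⟩

/-- The Duhamel map whose fixed point at the parameter `(t, x)` is the rescaled solution
`(τ, y) ↦ u (t τ) (x + y)`. -/
noncomputable def duhamelMap {H : ℝ × ℝ × ℝ → ℝ} (hH : BddDerivs H) {u₀ : ℝ → ℝ}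
    (hu₀ : BddDerivs u₀) (φ : ℝ → ℝ) (q : (ℝ × ℝ) × (ℝ × ℝ →ᵇ ℝ)) : ℝ × ℝ →ᵇ ℝ :=
  nemytskii sndField hu₀ (BoundedContinuousFunction.const (ℝ × ℝ) q.1.2)
    + φ q.1.1 • (clampFst *
        timeAverage (nullAverage (nemytskii baseField hH (jet (φ q.1.1) q.1.2 q.2))))

variable {H : ℝ × ℝ × ℝ → ℝ} (hH : BddDerivs H) {u₀ : ℝ → ℝ} (hu₀ : BddDerivs u₀)

theorem duhamelMap_apply (φ : ℝ → ℝ) (t x : ℝ) (U : ℝ × ℝ →ᵇ ℝ) (τ y : ℝ) :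
    duhamelMap hH hu₀ φ ((t, x), U) (τ, y) = u₀ (y + x) + φ t * (clamp τ *
      ∫ σ in (0 : ℝ)..1, ∫ ρ in (0 : ℝ)..1,
        H (φ t * clamp (clamp (clamp τ * σ) * ρ), y - 2 * Real.log ρ + x,
          U (clamp (clamp τ * σ) * ρ, y - 2 * Real.log ρ))) := by
  simp [duhamelMap, timeAverage_apply, nullAverage_apply, jet_apply, baseField, sndField]

theorem contDiff_duhamelMap {φ : ℝ → ℝ} (hφ : ContDiff ℝ ∞ φ) :
    ContDiff ℝ ∞ (duhamelMap hH hu₀ φ) := by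
  refine ContDiff.add ?_ (ContDiff.smul (hφ.comp (contDiff_fst.comp contDiff_fst))
    (contDiff_const.mul ?_))
  · exact (contDiff_nemytskii sndField hu₀).comp
      ((contDiff_boundedConst (ℝ × ℝ) ℝ).comp (contDiff_snd.comp contDiff_fst))
  · exact timeAverage.contDiff.comp (nullAverage.contDiff.comp
      ((contDiff_nemytskii baseField hH).comp (contDiff_jet hφ)))

theorem norm_duhamelMap_sub_le {φ : ℝ → ℝ} {L : ℝ} (hL : ∀ p q, ‖H p - H q‖ ≤ L * ‖p - q‖)
    (hφ : ∀ t, |φ t| * L ≤ 1 / 2) (p : ℝ × ℝ) (U V : ℝ × ℝ →ᵇ ℝ) :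
    ‖duhamelMap hH hu₀ φ (p, U) - duhamelMap hH hu₀ φ (p, V)‖ ≤ 1 / 2 * ‖U - V‖ := by
  set N := fun W => nemytskii baseField hH (jet (φ p.1) p.2 W)
  have hN : ‖N U - N V‖ ≤ L * ‖U - V‖ := by
    have hL0 : 0 ≤ L := by simpa using (norm_nonneg _).trans (hL (1, 0, 0) 0)
    refine (BoundedContinuousFunction.norm_le (by positivity)).2 fun k => ?_
    refine (hL _ _).trans (mul_le_mul_of_nonneg_left ?_ hL0)
    have h1 : ‖(U - V) k‖ ≤ ‖U - V‖ := (U - V).norm_coe_le_norm k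
    rw [add_sub_add_left_eq_sub, jet_apply, jet_apply]
    simpa [Prod.norm_def] using h1
  have h1 : duhamelMap hH hu₀ φ (p, U) - duhamelMap hH hu₀ φ (p, V)
      = φ p.1 • (clampFst * timeAverage (nullAverage (N U - N V))) := by
    simp only [duhamelMap, N, map_sub, mul_sub, smul_sub]
    abel
  have h2 : ‖clampFst * timeAverage (nullAverage (N U - N V))‖ ≤ L * ‖U - V‖ := by
    refine (norm_mul_le _ _).trans ?_
    refine (mul_le_of_le_one_left (norm_nonneg _) norm_clampFst_le).trans ?_
    exact (norm_flowAverage_le _ _ _ _).trans ((norm_flowAverage_le _ _ _ _).trans hN)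
  rw [h1, norm_smul, Real.norm_eq_abs]
  calc |φ p.1| * ‖clampFst * timeAverage (nullAverage (N U - N V))‖
      ≤ |φ p.1| * (L * ‖U - V‖) := mul_le_mul_of_nonneg_left h2 (abs_nonneg _)
    _ = |φ p.1| * L * ‖U - V‖ := by ring
    _ ≤ 1 / 2 * ‖U - V‖ := mul_le_mul_of_nonneg_right (hφ _) (norm_nonneg _)

/-- A fixed point of the Duhamel map at `(t, x)`, rescaled by `a` and translated by `y`, is a fixed
point at `(t', x + y)` whenever `φ t' = φ t * a`. -/
theorem duhamelMap_rescale {φ : ℝ → ℝ} {t t' x y a : ℝ} {U : ℝ × ℝ →ᵇ ℝ}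
    (hU : duhamelMap hH hu₀ φ ((t, x), U) = U) (ha0 : 0 ≤ a) (ha1 : a ≤ 1)
    (hφ : φ t' = φ t * a) {m : C(ℝ × ℝ, ℝ × ℝ)}
    (hm : ∀ k, m k = (a * clamp k.1, y + k.2)) :
    duhamelMap hH hu₀ φ ((t', x + y), U.compContinuous m) = U.compContinuous m := by
  ext ⟨τ, z⟩
  have hc0 := clamp_nonneg τ
  have hc1 := clamp_le_one τ
  have hac0 : 0 ≤ a * clamp τ := mul_nonneg ha0 hc0
  have hac1 : a * clamp τ ≤ 1 := mul_le_one₀ ha1 hc0 hc1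
  rw [BoundedContinuousFunction.compContinuous_apply, hm]
  conv_rhs => rw [← hU]
  rw [duhamelMap_apply, duhamelMap_apply, hφ, clamp_of_mem hac0 hac1]
  have hinner : ∀ σ ∈ Set.uIcc (0 : ℝ) 1,
      ∫ ρ in (0 : ℝ)..1, H (φ t * a * clamp (clamp (clamp τ * σ) * ρ),
          z - 2 * Real.log ρ + (x + y),
          U.compContinuous m (clamp (clamp τ * σ) * ρ, z - 2 * Real.log ρ))
        = ∫ ρ in (0 : ℝ)..1, H (φ t * clamp (clamp (a * clamp τ * σ) * ρ),
          y + z - 2 * Real.log ρ + x,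
          U (clamp (a * clamp τ * σ) * ρ, y + z - 2 * Real.log ρ)) := by
    intro σ hσ
    rw [Set.uIcc_of_le zero_le_one] at hσ
    have h0 : 0 ≤ clamp τ * σ := mul_nonneg hc0 hσ.1
    have h1 : clamp τ * σ ≤ 1 := mul_le_one₀ hc1 hσ.1 hσ.2
    refine intervalIntegral.integral_congr fun ρ hρ => ?_
    rw [Set.uIcc_of_le zero_le_one] at hρ
    have h2 : 0 ≤ a * clamp τ * σ := mul_nonneg hac0 hσ.1
    have h3 : a * clamp τ * σ ≤ 1 := mul_le_one₀ hac1 hσ.1 hσ.2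
    simp only [BoundedContinuousFunction.compContinuous_apply, hm, clamp_of_mem h0 h1,
      clamp_of_mem h2 h3, clamp_mul h0 h1 hρ.1 hρ.2, clamp_mul h2 h3 hρ.1 hρ.2]
    rw [show φ t * a * (clamp τ * σ * ρ) = φ t * (a * clamp τ * σ * ρ) by ring,
      show a * (clamp τ * σ * ρ) = a * clamp τ * σ * ρ by ring,
      show z - 2 * Real.log ρ + (x + y) = y + z - 2 * Real.log ρ + x by ring,
      show y + (z - 2 * Real.log ρ) = y + z - 2 * Real.log ρ by ring]
  rw [intervalIntegral.integral_congr hinner]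
  ring_nf

theorem duhamelMap_translate {φ : ℝ → ℝ} {c : ℝ} (hHp : ∀ t x z, H (t, x + c, z) = H (t, x, z))
    (hu₀p : Function.Periodic u₀ c) (t x : ℝ) (U : ℝ × ℝ →ᵇ ℝ) :
    duhamelMap hH hu₀ φ ((t, x + c), U) = duhamelMap hH hu₀ φ ((t, x), U) := by
  ext ⟨τ, y⟩
  simp only [duhamelMap_apply, ← add_assoc, hHp, hu₀p (y + x)]

include hH hu₀ in
/-- The Duhamel equation has a smooth periodic solution for small times. -/
theorem exists_duhamel_solution
    (hHp : ∀ t x z, H (t, x + 2 * Real.pi, z) = H (t, x, z))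
    (hu₀p : Function.Periodic u₀ (2 * Real.pi)) :
    ∃ T : ℝ, 0 < T ∧ ∃ u : ℝ → ℝ → ℝ, Smooth2 u ∧ Periodic2 u ∧
      ∀ t x, |t| ≤ T → u t x = u₀ x + t * ∫ σ in (0 : ℝ)..1, ∫ ρ in (0 : ℝ)..1,
        H (t * σ * ρ, x - 2 * Real.log ρ, u (t * σ * ρ) (x - 2 * Real.log ρ)) := by
  obtain ⟨L, hL0, hL⟩ := hH.lipschitz
  set T₀ : ℝ := 1 / (2 * (L + 1)) with hT₀
  have hT₀pos : 0 < T₀ := by positivity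
  have hT₀L : T₀ * L ≤ 1 / 2 := by
    rw [hT₀, div_mul_eq_mul_div, div_le_div_iff₀ (by positivity) two_pos]
    linarith
  let χ : ContDiffBump (0 : ℝ) := ⟨T₀ / 2, T₀, by linarith, by linarith⟩
  let φ : ℝ → ℝ := fun t => t * χ t
  have hφ : ContDiff ℝ ∞ φ := contDiff_id.mul χ.contDiff
  have hφ1 : ∀ t, |t| ≤ T₀ / 2 → φ t = t := fun t ht => by
    simp only [φ]
    rw [χ.one_of_mem_closedBall (by simpa [χ] using ht), mul_one]
  have hφ2 : ∀ t, |φ t| ≤ T₀ := fun t => by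
    simp only [φ, abs_mul, abs_of_nonneg χ.nonneg]
    rcases le_or_gt T₀ |t| with h | h
    · rw [χ.zero_of_le_dist (by simpa [χ] using h), mul_zero]
      exact hT₀pos.le
    · exact (mul_le_of_le_one_right (abs_nonneg t) χ.le_one).trans h.le
  obtain ⟨S, hS, hfix⟩ := exists_contDiff_fixedPoint (duhamelMap hH hu₀ φ)
    (contDiff_duhamelMap hH hu₀ hφ) (norm_duhamelMap_sub_le hH hu₀ hL fun t =>
      (mul_le_mul_of_nonneg_right (hφ2 t) hL0).trans hT₀L)
  have hSfix : ∀ p, duhamelMap hH hu₀ φ (p, S p) = S p := fun p => (hfix p _).2 rfl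
  have hrescale : ∀ t x a y, |t| ≤ T₀ / 2 → 0 ≤ a → a ≤ 1 →
      S (t, x) (a, y) = S (t * a, x + y) (1, 0) := fun t x a y ht ha0 ha1 => by
    let m : C(ℝ × ℝ, ℝ × ℝ) := ⟨fun k => (a * clamp k.1, y + k.2), by
      have := continuous_clamp; fun_prop⟩
    have hta : |t * a| ≤ T₀ / 2 := by
      rw [abs_mul, abs_of_nonneg ha0]
      exact (mul_le_of_le_one_right (abs_nonneg t) ha1).trans ht
    have h1 := (hfix (t * a, x + y) _).1 (duhamelMap_rescale hH hu₀ (hSfix (t, x)) ha0 ha1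
      (by rw [hφ1 _ hta, hφ1 _ ht]) (m := m) (fun _ => rfl))
    rw [← h1, BoundedContinuousFunction.compContinuous_apply]
    simp [m, clamp_of_mem zero_le_one le_rfl]
  refine ⟨T₀ / 2, by positivity, fun t x => S (t, x) (1, 0), ?_, fun t x => ?_, fun t x ht => ?_⟩
  · exact (BoundedContinuousFunction.evalCLM ℝ ((1, 0) : ℝ × ℝ)).contDiff.comp hS
  · have h1 : S (t, x + 2 * Real.pi) = S (t, x) := by
      refine (hfix (t, x) _).1 ?_
      rw [← duhamelMap_translate hH hu₀ hHp hu₀p]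
      exact hSfix _
    simp only [h1]
  · have h1 : clamp 1 = 1 := clamp_of_mem zero_le_one le_rfl
    have h2 := DFunLike.congr_fun (hSfix (t, x)) (1, 0)
    beta_reduce
    rw [← h2, duhamelMap_apply, h1, hφ1 t ht, zero_add, one_mul]
    congr 2
    refine intervalIntegral.integral_congr fun σ hσ => ?_
    refine intervalIntegral.integral_congr fun ρ hρ => ?_
    rw [Set.uIcc_of_le zero_le_one] at hσ hρ
    simp only [one_mul, zero_sub, clamp_of_mem hσ.1 hσ.2, clamp_mul hσ.1 hσ.2 hρ.1 hρ.2]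
    rw [hrescale t x _ _ ht (mul_nonneg hσ.1 hρ.1) (mul_le_one₀ hσ.2 hρ.1 hρ.2)]
    ring_nf

end Existence

/-- Local well-posedness for the admissible semi-linear scalar wave equation
`□u = F(t, x, u)` on the Misner spacetime, with data on the Cauchy horizon. -/
theorem stmt4 (F : ℝ → ℝ → ℝ → ℝ)
    (hF : ContDiff ℝ (⊤ : ℕ∞) (fun p : ℝ × ℝ × ℝ => F p.1 p.2.1 p.2.2))
    (hFp : ∀ t x z : ℝ, F t (x + 2 * Real.pi) z = F t x z)
    (u₀ : ℝ → ℝ) (hu₀ : ContDiff ℝ (⊤ : ℕ∞) u₀) (hu₀p : Function.Periodic u₀ (2 * Real.pi)) :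
    ∃ T : ℝ, 0 < T ∧ ∃ u : ℝ → ℝ → ℝ,
      Smooth2 u ∧ Periodic2 u ∧
      (∀ t x : ℝ, 0 ≤ t → t < T → MisnerBox u t x = F t x (u t x)) ∧
      (∀ x : ℝ, u 0 x = u₀ x) ∧
      (∀ T' : ℝ, 0 < T' → ∀ v : ℝ → ℝ → ℝ, Smooth2 v → Periodic2 v →
        (∀ t x : ℝ, 0 ≤ t → t < T' → MisnerBox v t x = F t x (v t x)) →
        (∀ x : ℝ, v 0 x = u₀ x) →
        ∀ t x : ℝ, 0 ≤ t → t < min T T' → v t x = u t x) := by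
  have hB₀ := BddDerivs.of_periodic hu₀ Real.two_pi_pos hu₀p
  obtain ⟨C, hC0, hC⟩ := hB₀.bdd
  obtain ⟨H, hH, hHp, hHF⟩ := exists_bddDerivs_eq hF Real.two_pi_pos hFp
    (R := C + 1) (by positivity)
  obtain ⟨M, hM0, hM⟩ := hH.bdd
  obtain ⟨T₁, hT₁, u, hu, hup, hduh⟩ := exists_duhamel_solution hH hB₀ hHp hu₀p
  have huc : Continuous (fun p : ℝ × ℝ => u p.1 p.2) := ContDiff.continuous hu
  set T : ℝ := min T₁ (1 / (M + 1)) with hT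
  have hTpos : 0 < T := lt_min hT₁ (by positivity)
  have hTM : T * M ≤ 1 := by
    have h1 : T ≤ 1 / (M + 1) := min_le_right _ _
    rw [le_div_iff₀ (by positivity)] at h1
    linarith
  have hT1 : T ≤ 1 := (min_le_right _ _).trans (by
    rw [div_le_one (by positivity)]
    linarith)
  have hu0 : ∀ x, u 0 x = u₀ x := fun x => by
    rw [hduh 0 x (by simpa using hT₁.le)]
    simp
  have hsol : ∀ t x : ℝ, 0 ≤ t → t < T → MisnerBox u t x = F t x (u t x) := fun t x ht0 htT => by
    have hbox := misnerBox_eq_of_duhamel (u := u) (f := fun t x => H (t, x, u t x)) (T := T)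
      (M := M) hu (hH.1.continuous.comp (continuous_fst.prodMk (continuous_snd.prodMk huc)))
      (fun t x => hM _) (fun t x ht => hduh t x (ht.le.trans (min_le_left _ _))) x
      (by rwa [abs_of_nonneg ht0])
    rw [hbox]
    refine hHF t x _ (by rw [abs_of_nonneg ht0]; linarith) ?_
    rw [hduh t x (by rw [abs_of_nonneg ht0]; exact htT.le.trans (min_le_left _ _))]
    refine (abs_add_le _ _).trans (add_le_add (hC x) ?_)
    have hin : ∀ σ, ‖∫ ρ in (0 : ℝ)..1, H (t * σ * ρ, x - 2 * Real.log ρ,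
        u (t * σ * ρ) (x - 2 * Real.log ρ))‖ ≤ M := fun σ => by
      simpa using intervalIntegral.norm_integral_le_of_norm_le_const (a := 0) (b := 1)
        (f := fun ρ => H (t * σ * ρ, x - 2 * Real.log ρ, u (t * σ * ρ) (x - 2 * Real.log ρ)))
        (fun ρ _ => hM _)
    have hout := intervalIntegral.norm_integral_le_of_norm_le_const (a := 0) (b := 1)
      (fun σ _ => hin σ)
    rw [sub_zero, abs_one, mul_one, Real.norm_eq_abs] at hout
    rw [abs_mul, abs_of_nonneg ht0]
    exact (mul_le_mul htT.le hout (abs_nonneg _) hTpos.le).trans hTM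
  refine ⟨T, hTpos, u, hu, hup, hsol, hu0, fun T' _ v hv hvp hvsol hv0 t x ht0 htT => ?_⟩
  have h1 : t < T := htT.trans_le (min_le_left _ _)
  have h2 : t < T' := htT.trans_le (min_le_right _ _)
  exact misner_unique hF hFp hv hvp hu hup (a := t)
    (fun s y hs0 hst => hvsol s y hs0 (hst.trans_lt h2))
    (fun s y hs0 hst => hsol s y hs0 (hst.trans_lt h1))
    (fun y => by rw [hv0, hu0]) t x ht0 le_rfl
end

section
/- Let Pu = t·∂_t²u − 2·∂_x∂_t u + ∂_t u + a·∂_x u + b·∂_t u + c·u with a, b, c smooth on [0,1]×ℝ and 2π-periodic in x. For every m ∈ ℕ there exists a constant D_m > 0 such that for all 0 < t₀ ≤ t₁ ≤ 1 and every u smooth on [t₀,t₁]×ℝ and 2π-periodic in x one has ‖u(t₁,·)‖_{H^{2m+1}} + √t₁·‖∂_t u(t₁,·)‖_{H^{2m}} ≤ D_m·(t₁/t₀)^{D_m}·(‖u(t₀,·)‖_{H^{2m+1}} + √t₀·‖∂_t u(t₀,·)‖_{H^{2m}}) + D_m·t₁^{D_m}·∫_{t₀}^{t₁} ‖(Pu)(t,·)‖_{H^{2m}}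 · t^{−D_m−1/2} dt. -/
/-- A general scalar wave operator on the Misner spacetime:
`Pu = t·∂ₜ²u − 2·∂ₓ∂ₜu + ∂ₜu + a·∂ₓu + b·∂ₜu + c·u`. -/
noncomputable def MisnerP (a b c u : ℝ → ℝ → ℝ) : ℝ → ℝ → ℝ := fun t x =>
  t * pt (pt u) t x - 2 * px (pt u) t x + pt u t x
    + a t x * px u t x + b t x * pt u t x + c t x * u t x

/-- Sobolev norm of a (`2π`-periodic) function on the circle:
`‖w‖_{H^k}² = Σ_{j=0}^{k} ∫₀^{2π} (∂ₓʲ w)²`. -/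
noncomputable def sobNorm (k : ℕ) (w : ℝ → ℝ) : ℝ :=
  Real.sqrt (∑ j ∈ Finset.range (k + 1),
    ∫ x in (0:ℝ)..(2 * Real.pi), (iteratedDeriv j w x) ^ 2)

namespace Misner

open Set Filter Topology MeasureTheory

variable {u v : ℝ → ℝ → ℝ}

theorem pt_eq_fderiv (hu : Smooth2 u) (t x : ℝ) :
    pt u t x = fderiv ℝ (fun p : ℝ × ℝ => u p.1 p.2) (t, x) (1, 0) := by
  have h1 : HasFDerivAt (fun p : ℝ × ℝ => u p.1 p.2) _ (t, x) :=
    (hu.differentiable (by simp) (t, x)).hasFDerivAt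
  have h2 : HasDerivAt (fun s : ℝ => (s, x)) ((1 : ℝ), (0 : ℝ)) t :=
    (hasDerivAt_id t).prodMk (hasDerivAt_const t x)
  exact (h1.comp_hasDerivAt t h2).deriv

theorem px_eq_fderiv (hu : Smooth2 u) (t x : ℝ) :
    px u t x = fderiv ℝ (fun p : ℝ × ℝ => u p.1 p.2) (t, x) (0, 1) := by
  have h1 : HasFDerivAt (fun p : ℝ × ℝ => u p.1 p.2) _ (t, x) :=
    (hu.differentiable (by simp) (t, x)).hasFDerivAt
  have h2 : HasDerivAt (fun y : ℝ => (t, y)) ((0 : ℝ), (1 : ℝ)) x :=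
    (hasDerivAt_const x t).prodMk (hasDerivAt_id x)
  exact (h1.comp_hasDerivAt x h2).deriv

theorem smooth2_pt (hu : Smooth2 u) : Smooth2 (pt u) := by
  have : (fun p : ℝ × ℝ => pt u p.1 p.2)
      = fun p => fderiv ℝ (fun p : ℝ × ℝ => u p.1 p.2) p (1, 0) :=
    funext fun p => pt_eq_fderiv hu p.1 p.2
  unfold Smooth2
  rw [this]
  exact (ContDiff.fderiv_right hu (by simp)).clm_apply contDiff_const

theorem smooth2_px (hu : Smooth2 u) : Smooth2 (px u) := by
  have : (fun p : ℝ × ℝ => px u p.1 p.2)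
      = fun p => fderiv ℝ (fun p : ℝ × ℝ => u p.1 p.2) p (0, 1) :=
    funext fun p => px_eq_fderiv hu p.1 p.2
  unfold Smooth2
  rw [this]
  exact (ContDiff.fderiv_right hu (by simp)).clm_apply contDiff_const

theorem hasDerivAt_pt (hu : Smooth2 u) (t x : ℝ) :
    HasDerivAt (fun s => u s x) (pt u t x) t := by
  have h : ContDiff ℝ (⊤ : ℕ∞) (fun s => u s x) :=
    ContDiff.comp (g := fun p : ℝ × ℝ => u p.1 p.2) (f := fun s : ℝ => (s, x)) hu (by fun_prop)
  exact (h.differentiable (by simp) t).hasDerivAt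

theorem hasDerivAt_px (hu : Smooth2 u) (t x : ℝ) :
    HasDerivAt (u t) (px u t x) x := by
  have h : ContDiff ℝ (⊤ : ℕ∞) (fun y => u t y) :=
    ContDiff.comp (g := fun p : ℝ × ℝ => u p.1 p.2) (f := fun y : ℝ => (t, y)) hu (by fun_prop)
  exact (h.differentiable (by simp) x).hasDerivAt

theorem px_pt_comm (hu : Smooth2 u) : px (pt u) = pt (px u) := by
  funext t x
  rw [px_eq_fderiv (smooth2_pt hu), pt_eq_fderiv (smooth2_px hu)]
  have e1 : (fun p : ℝ × ℝ => pt u p.1 p.2)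
      = fun p => fderiv ℝ (fun p : ℝ × ℝ => u p.1 p.2) p (1, 0) :=
    funext fun p => pt_eq_fderiv hu p.1 p.2
  have e2 : (fun p : ℝ × ℝ => px u p.1 p.2)
      = fun p => fderiv ℝ (fun p : ℝ × ℝ => u p.1 p.2) p (0, 1) :=
    funext fun p => px_eq_fderiv hu p.1 p.2
  have hd : DifferentiableAt ℝ (fderiv ℝ (fun p : ℝ × ℝ => u p.1 p.2)) (t, x) :=
    (ContDiff.fderiv_right (m := (⊤ : ℕ∞)) hu (by simp)).differentiable (by simp) _
  have hs : IsSymmSndFDerivAt ℝ (fun p : ℝ × ℝ => u p.1 p.2) (t, x) :=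
    (ContDiff.contDiffAt hu).isSymmSndFDerivAt (by
      rw [minSmoothness_of_isRCLikeNormedField]; exact WithTop.coe_le_coe.2 (le_top : (2 : ℕ∞) ≤ ⊤))
  rw [e1, e2, fderiv_clm_apply hd (by fun_prop), fderiv_clm_apply hd (by fun_prop)]
  simpa using hs (0, 1) (1, 0)

theorem px_add (hu : Smooth2 u) (hv : Smooth2 v) :
    px (fun t x => u t x + v t x) = fun t x => px u t x + px v t x := by
  funext t x
  exact ((hasDerivAt_px hu t x).add (hasDerivAt_px hv t x)).deriv

theorem px_mul (hu : Smooth2 u) (hv : Smooth2 v) :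
    px (fun t x => u t x * v t x) = fun t x => px u t x * v t x + u t x * px v t x := by
  funext t x
  exact ((hasDerivAt_px hu t x).mul (hasDerivAt_px hv t x)).deriv

theorem smooth2_add (hu : Smooth2 u) (hv : Smooth2 v) :
    Smooth2 (fun t x => u t x + v t x) := ContDiff.add hu hv

theorem smooth2_mul (hu : Smooth2 u) (hv : Smooth2 v) :
    Smooth2 (fun t x => u t x * v t x) := ContDiff.mul hu hv

theorem smooth2_iter (hu : Smooth2 u) (k : ℕ) : Smooth2 (px^[k] u) := by
  induction k with
  | zero => exact hu
  | succ k ih => rw [Function.iterate_succ_apply']; exact smooth2_px ih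

theorem iter_pt_comm (hu : Smooth2 u) (k : ℕ) : px^[k] (pt u) = pt (px^[k] u) := by
  induction k with
  | zero => rfl
  | succ k ih =>
    rw [Function.iterate_succ_apply', Function.iterate_succ_apply', ih,
      px_pt_comm (smooth2_iter hu k)]

theorem iter_add (k : ℕ) : ∀ {u v : ℝ → ℝ → ℝ}, Smooth2 u → Smooth2 v →
    px^[k] (fun t x => u t x + v t x) = fun t x => px^[k] u t x + px^[k] v t x := by
  induction k with
  | zero => intros; rfl
  | succ k ih =>
    intro u v hu hv
    rw [Function.iterate_succ_apply, px_add hu hv, ih (smooth2_px hu) (smooth2_px hv)]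
    rfl

theorem iteratedDeriv_eq_iter (k : ℕ) (u : ℝ → ℝ → ℝ) (t : ℝ) :
    iteratedDeriv k (u t) = px^[k] u t := by
  rw [iteratedDeriv_eq_iterate]
  induction k with
  | zero => rfl
  | succ k ih => rw [Function.iterate_succ_apply', Function.iterate_succ_apply', ih]; rfl

theorem periodic2_px (hp : Periodic2 u) : Periodic2 (px u) := by
  intro t x
  have h : (fun y => u t (y + 2 * Real.pi)) = fun y => u t y := funext (hp t)
  have := deriv_comp_add_const (u t) (2 * Real.pi) x
  unfold px
  rw [← this, h]

theorem periodic2_pt (hp : Periodic2 u) : Periodic2 (pt u) := by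
  intro t x
  simp only [pt, hp _ x]

theorem periodic2_iter (hp : Periodic2 u) (k : ℕ) : Periodic2 (px^[k] u) := by
  induction k with
  | zero => exact hp
  | succ k ih => rw [Function.iterate_succ_apply']; exact periodic2_px ih

theorem continuous_uncurry (hu : Smooth2 u) : Continuous (fun p : ℝ × ℝ => u p.1 p.2) :=
  ContDiff.continuous hu

theorem continuous_slice (hu : Smooth2 u) (t : ℝ) : Continuous (u t) :=
  (continuous_uncurry hu).comp (f := fun x : ℝ => (t, x)) (by fun_prop)

theorem intervalIntegrable_slice (hu : Smooth2 u) (t a b : ℝ) :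
    IntervalIntegrable (u t) volume a b :=
  (continuous_slice hu t).intervalIntegrable a b

/-- Differentiation under the integral sign over one period. -/
theorem hasDerivAt_integral (hu : Smooth2 u) (t : ℝ) :
    HasDerivAt (fun t => ∫ x in (0:ℝ)..(2 * Real.pi), u t x)
      (∫ x in (0:ℝ)..(2 * Real.pi), pt u t x) t := by
  have hK : IsCompact (Metric.closedBall t 1 ×ˢ uIcc (0:ℝ) (2 * Real.pi)) :=
    (isCompact_closedBall t 1).prod isCompact_uIcc
  obtain ⟨C, hC⟩ := hK.exists_bound_of_continuousOn
    (continuous_uncurry (smooth2_pt hu)).continuousOn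
  refine (intervalIntegral.hasDerivAt_integral_of_dominated_loc_of_deriv_le
    (F := u) (F' := pt u) (bound := fun _ => C) (Metric.closedBall_mem_nhds t one_pos)
    (Eventually.of_forall fun s => (continuous_slice hu s).aestronglyMeasurable)
    (intervalIntegrable_slice hu t _ _)
    (continuous_slice (smooth2_pt hu) t).aestronglyMeasurable
    (Eventually.of_forall fun x hx s hs => hC (s, x) ⟨hs, uIoc_subset_uIcc hx⟩)
    intervalIntegrable_const
    (Eventually.of_forall fun x _ s _ => hasDerivAt_pt hu s x)).2

theorem integral_px_eq_zero (hu : Smooth2 u) (hp : Periodic2 u) (t : ℝ) :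
    ∫ x in (0:ℝ)..(2 * Real.pi), px u t x = 0 := by
  rw [intervalIntegral.integral_eq_sub_of_hasDerivAt (fun x _ => hasDerivAt_px hu t x)
    (intervalIntegrable_slice (smooth2_px hu) t _ _)]
  have := hp t 0
  rw [zero_add] at this
  rw [this, sub_self]

theorem integral_mul_le_sqrt_mul_sqrt {f g : ℝ → ℝ} (hf : Continuous f) (hg : Continuous g)
    {a b : ℝ} (hab : a ≤ b) :
    ∫ x in a..b, f x * g x ≤
      Real.sqrt (∫ x in a..b, f x ^ 2) * Real.sqrt (∫ x in a..b, g x ^ 2) := by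
  have key : ∀ l : ℝ, 0 ≤ (∫ x in a..b, f x ^ 2) * (l * l)
      + (2 * ∫ x in a..b, f x * g x) * l + ∫ x in a..b, g x ^ 2 := by
    intro l
    have h : 0 ≤ ∫ x in a..b, (l * f x + g x) ^ 2 :=
      intervalIntegral.integral_nonneg hab fun x _ => sq_nonneg _
    have e : ∫ x in a..b, (l * f x + g x) ^ 2 = ∫ x in a..b,
        ((l * l) * f x ^ 2 + (2 * l) * (f x * g x) + g x ^ 2) := by
      congr 1; funext x; ring
    rw [e, intervalIntegral.integral_add, intervalIntegral.integral_add,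
      intervalIntegral.integral_const_mul, intervalIntegral.integral_const_mul] at h
    · linarith
    all_goals exact Continuous.intervalIntegrable (by fun_prop) _ _
  have hd := discrim_le_zero key
  unfold discrim at hd
  have hA : 0 ≤ ∫ x in a..b, f x ^ 2 :=
    intervalIntegral.integral_nonneg hab fun x _ => sq_nonneg _
  rw [← Real.sqrt_mul hA]
  exact Real.le_sqrt_of_sq_le (by nlinarith)

/-- The energy density of the Misner wave operator. -/
noncomputable def energyDensity (v : ℝ → ℝ → ℝ) : ℝ → ℝ → ℝ := fun t x =>
  v t x ^ 2 + px v t x ^ 2 - t * px v t x * pt v t x + t * pt v t x ^ 2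

/-- The principal part `t·∂ₜ² − 2·∂ₓ∂ₜ` of the Misner wave operator. -/
noncomputable def principal (v : ℝ → ℝ → ℝ) : ℝ → ℝ → ℝ := fun t x =>
  t * pt (pt v) t x - 2 * px (pt v) t x

/-- The lower order part of the Misner wave operator. -/
noncomputable def lowerOrder (a b c u : ℝ → ℝ → ℝ) : ℝ → ℝ → ℝ := fun t x =>
  pt u t x + (a t x * px u t x + (b t x * pt u t x + c t x * u t x))

/-- The time derivative of the energy density, up to a total space derivative. -/
noncomputable def energyFlux (v f : ℝ → ℝ → ℝ) : ℝ → ℝ → ℝ := fun t x =>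
  2 * v t x * pt v t x - px v t x * pt v t x + pt v t x ^ 2
    + (2 * pt v t x - px v t x) * f t x

theorem smooth2_energyDensity (hv : Smooth2 v) : Smooth2 (energyDensity v) := by
  have h1 := hv
  have h2 := smooth2_px hv
  have h3 := smooth2_pt hv
  unfold Smooth2 energyDensity at *
  fun_prop

theorem smooth2_principal (hv : Smooth2 v) : Smooth2 (principal v) := by
  have h1 := smooth2_pt (smooth2_pt hv)
  have h2 := smooth2_px (smooth2_pt hv)
  unfold Smooth2 principal at *
  fun_prop

theorem smooth2_lowerOrder {a b c : ℝ → ℝ → ℝ} (ha : Smooth2 a) (hb : Smooth2 b)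
    (hc : Smooth2 c) (hv : Smooth2 v) : Smooth2 (lowerOrder a b c v) := by
  have h1 := smooth2_pt hv
  have h2 := smooth2_px hv
  unfold Smooth2 lowerOrder at *
  fun_prop

theorem smooth2_energyFlux {f : ℝ → ℝ → ℝ} (hv : Smooth2 v) (hf : Smooth2 f) :
    Smooth2 (energyFlux v f) := by
  have h1 := smooth2_pt hv
  have h2 := smooth2_px hv
  unfold Smooth2 energyFlux at *
  fun_prop

theorem pt_energyDensity (hv : Smooth2 v) (t x : ℝ) :
    pt (energyDensity v) t x = energyFlux v (principal v) t x
      + px (fun t x => (2 - t / 2) * pt v t x ^ 2) t x := by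
  have h1 := hasDerivAt_pt hv t x
  have h2 := hasDerivAt_pt (smooth2_px hv) t x
  have h3 := hasDerivAt_pt (smooth2_pt hv) t x
  have h4 := hasDerivAt_px (smooth2_pt hv) t x
  have e1 := ((((h1.pow 2).add (h2.pow 2)).sub (((hasDerivAt_id t).mul h2).mul h3)).add
    ((hasDerivAt_id t).mul (h3.pow 2))).deriv
  have e2 := ((h4.pow 2).const_mul (2 - t / 2)).deriv
  have e1' : pt (energyDensity v) t x = _ := e1
  have e2' : px (fun t x => (2 - t / 2) * pt v t x ^ 2) t x = _ := e2
  rw [e1', e2', ← px_pt_comm hv]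
  simp only [energyFlux, principal, id, Pi.mul_apply, Pi.pow_apply]
  push_cast
  ring

theorem hasDerivAt_energy (hv : Smooth2 v) (hp : Periodic2 v) (t : ℝ) :
    HasDerivAt (fun t => ∫ x in (0:ℝ)..(2 * Real.pi), energyDensity v t x)
      (∫ x in (0:ℝ)..(2 * Real.pi), energyFlux v (principal v) t x) t := by
  have h := hasDerivAt_integral (smooth2_energyDensity hv) t
  have hs : Smooth2 (fun t x => (2 - t / 2) * pt v t x ^ 2) := by
    have := smooth2_pt hv
    unfold Smooth2 at *
    fun_prop
  have hq : Periodic2 (fun t x => (2 - t / 2) * pt v t x ^ 2) := by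
    intro t x
    simp only [periodic2_pt hp t x]
  rw [show (∫ x in (0:ℝ)..(2 * Real.pi), pt (energyDensity v) t x)
      = ∫ x in (0:ℝ)..(2 * Real.pi), energyFlux v (principal v) t x from ?_] at h
  · exact h
  · simp only [pt_energyDensity hv]
    rw [intervalIntegral.integral_add
      (intervalIntegrable_slice (smooth2_energyFlux hv (smooth2_principal hv)) t _ _)
      (intervalIntegrable_slice (smooth2_px hs) t _ _), integral_px_eq_zero hs hq, add_zero]

theorem px_principal (hv : Smooth2 v) : px (principal v) = principal (px v) := by
  have h1 := smooth2_pt (smooth2_pt hv)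
  have h2 := smooth2_px (smooth2_pt hv)
  funext t x
  have e : px (principal v) t x = _ :=
    (((hasDerivAt_px h1 t x).const_mul t).sub ((hasDerivAt_px h2 t x).const_mul 2)).deriv
  rw [e]
  simp only [principal]
  rw [px_pt_comm (smooth2_pt hv), px_pt_comm hv]

theorem iter_principal (hv : Smooth2 v) (k : ℕ) :
    px^[k] (principal v) = principal (px^[k] v) := by
  induction k with
  | zero => rfl
  | succ k ih =>
    rw [Function.iterate_succ_apply', Function.iterate_succ_apply', ih,
      px_principal (smooth2_iter hv k)]

theorem misnerP_eq (a b c u : ℝ → ℝ → ℝ) :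
    MisnerP a b c u = fun t x => principal u t x + lowerOrder a b c u t x := by
  funext t x
  simp only [MisnerP, principal, lowerOrder]
  ring

theorem exists_bound_of_smooth2 {a : ℝ → ℝ → ℝ} (ha : Smooth2 a) :
    ∃ C : ℝ, 0 ≤ C ∧ ∀ t ∈ Icc (0:ℝ) 1, ∀ x ∈ Icc (0:ℝ) (2 * Real.pi), |a t x| ≤ C := by
  obtain ⟨C, hC⟩ := (isCompact_Icc.prod isCompact_Icc :
    IsCompact (Icc (0:ℝ) 1 ×ˢ Icc (0:ℝ) (2 * Real.pi))).exists_bound_of_continuousOn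
    (continuous_uncurry ha).continuousOn
  exact ⟨max C 0, le_max_right _ _, fun t ht x hx => (hC (t, x) ⟨ht, hx⟩).trans (le_max_left _ _)⟩

/-- A pointwise form of the Leibniz rule. -/
theorem exists_bound_iter_mul (k : ℕ) : ∀ {a : ℝ → ℝ → ℝ}, Smooth2 a →
    ∃ C : ℝ, 0 ≤ C ∧ ∀ w : ℝ → ℝ → ℝ, Smooth2 w → ∀ t ∈ Icc (0:ℝ) 1,
      ∀ x ∈ Icc (0:ℝ) (2 * Real.pi),
        |px^[k] (fun t x => a t x * w t x) t x|
          ≤ C * ∑ j ∈ Finset.range (k + 1), |px^[j] w t x| := by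
  induction k with
  | zero =>
    intro a ha
    obtain ⟨C, hC0, hC⟩ := exists_bound_of_smooth2 ha
    refine ⟨C, hC0, fun w _ t ht x hx => ?_⟩
    simp only [Function.iterate_zero, id, zero_add, Finset.range_one, Finset.sum_singleton, abs_mul]
    exact mul_le_mul_of_nonneg_right (hC t ht x hx) (abs_nonneg _)
  | succ k ih =>
    intro a ha
    obtain ⟨C, hC0, hC⟩ := ih ha
    obtain ⟨C', hC0', hC'⟩ := ih (smooth2_px ha)
    refine ⟨C' + C, by positivity, fun w hw t ht x hx => ?_⟩
    rw [Function.iterate_succ_apply, px_mul ha hw,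
      iter_add k (smooth2_mul (smooth2_px ha) hw) (smooth2_mul ha (smooth2_px hw)), add_mul]
    refine (abs_add_le _ _).trans (add_le_add ((hC' w hw t ht x hx).trans ?_)
      ((hC (px w) (smooth2_px hw) t ht x hx).trans ?_))
    · gcongr
      simp
    · gcongr
      rw [Finset.sum_range_succ' _ (k + 1)]
      simp only [Function.iterate_succ_apply]
      linarith [abs_nonneg (px^[0] w t x)]

/-- A Grönwall inequality with a singular coefficient `1/t`, for the square root of an energy. -/
theorem sqrt_gronwall {E E' G : ℝ → ℝ} {C K t₀ t₁ : ℝ} (h0 : 0 < t₀) (h01 : t₀ ≤ t₁)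
    (hC : 0 ≤ C) (hK : 0 ≤ K) (hE : ∀ t, 0 < t → t ≤ t₁ → 0 ≤ E t)
    (hd : ∀ t, HasDerivAt E (E' t) t) (hG : Continuous G) (hG0 : ∀ t, 0 ≤ G t)
    (hE' : ∀ t, 0 < t → t ≤ t₁ →
      E' t ≤ 2 * C / t * E t + 2 * K * t ^ (-(1/2) : ℝ) * (Real.sqrt (E t) * G t)) :
    Real.sqrt (E t₁) ≤ (t₁ / t₀) ^ C * Real.sqrt (E t₀)
      + K * t₁ ^ C * ∫ t in t₀..t₁, G t * t ^ (-C - 1/2) := by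
  have h1 : 0 < t₁ := h0.trans_le h01
  have key : ∀ ε : ℝ, 0 < ε → t₁ ^ (-C) * Real.sqrt (E t₁ + ε)
      ≤ t₀ ^ (-C) * Real.sqrt (E t₀ + ε) + K * ∫ t in t₀..t₁, G t * t ^ (-C - 1/2) := by
    intro ε hε
    have hder : ∀ t, 0 < t → t ≤ t₁ →
        HasDerivAt (fun t => t ^ (-C) * Real.sqrt (E t + ε))
          ((-C) * t ^ (-C - 1) * Real.sqrt (E t + ε)
            + t ^ (-C) * (E' t / (2 * Real.sqrt (E t + ε)))) t := by
      intro t ht ht1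
      have hp := hE t ht ht1
      exact (Real.hasDerivAt_rpow_const (Or.inl ht.ne')).mul
        (((hd t).add_const ε).sqrt (by positivity))
    have hcont : ContinuousOn (fun t => K * (G t * t ^ (-C - 1/2))) (Icc t₀ t₁) := by
      refine continuousOn_const.mul (hG.continuousOn.mul ?_)
      exact continuousOn_id.rpow_const fun t ht => Or.inl (h0.trans_le ht.1).ne'
    have := intervalIntegral.sub_le_integral_of_hasDeriv_right_of_le h01
      (fun t ht => (hder t (h0.trans_le ht.1) ht.2).continuousAt.continuousWithinAt)
      (fun t ht => (hder t (h0.trans ht.1) ht.2.le).hasDerivWithinAt)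
      (hcont.integrableOn_Icc) (fun t ht => ?_)
    · rw [intervalIntegral.integral_const_mul] at this
      linarith
    · have htp : 0 < t := h0.trans ht.1
      have hEt := hE t htp ht.2.le
      have hF : 0 < Real.sqrt (E t + ε) := Real.sqrt_pos.2 (by positivity)
      have hF2 : Real.sqrt (E t + ε) ^ 2 = E t + ε := Real.sq_sqrt (by positivity)
      have hle : Real.sqrt (E t) ≤ Real.sqrt (E t + ε) := Real.sqrt_le_sqrt (by linarith)
      set F := Real.sqrt (E t + ε) with hFdef
      have hq : E' t / (2 * F) ≤ C / t * F + K * t ^ (-(1/2) : ℝ) * G t := by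
        rw [div_le_iff₀ (by positivity)]
        refine (hE' t htp ht.2.le).trans ?_
        have a1 : 2 * C / t * E t ≤ 2 * C / t * F ^ 2 :=
          mul_le_mul_of_nonneg_left (by linarith) (by positivity)
        have a2 : 2 * K * t ^ (-(1/2) : ℝ) * (Real.sqrt (E t) * G t)
            ≤ 2 * K * t ^ (-(1/2) : ℝ) * (F * G t) :=
          mul_le_mul_of_nonneg_left (mul_le_mul_of_nonneg_right hle (hG0 t)) (by positivity)
        calc _ ≤ _ := add_le_add a1 a2
          _ = _ := by ring
      have e1 : t ^ (-C - 1) = t ^ (-C) / t := Real.rpow_sub_one htp.ne' _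
      have e2 : t ^ (-C - 1/2) = t ^ (-C) * t ^ (-(1/2) : ℝ) := by
        rw [← Real.rpow_add htp]; ring_nf
      rw [e1, e2]
      calc _ ≤ -C * (t ^ (-C) / t) * F + t ^ (-C) * (C / t * F + K * t ^ (-(1/2) : ℝ) * G t) := by
            gcongr
        _ = _ := by ring
  have lim : t₁ ^ (-C) * Real.sqrt (E t₁)
      ≤ t₀ ^ (-C) * Real.sqrt (E t₀) + K * ∫ t in t₀..t₁, G t * t ^ (-C - 1/2) := by
    have c1 : Continuous fun ε : ℝ => t₁ ^ (-C) * Real.sqrt (E t₁ + ε) := by fun_prop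
    have c2 : Continuous fun ε : ℝ => t₀ ^ (-C) * Real.sqrt (E t₀ + ε)
        + K * ∫ t in t₀..t₁, G t * t ^ (-C - 1/2) := by fun_prop
    have l1 := (c1.tendsto 0).mono_left (nhdsWithin_le_nhds (s := Ioi 0))
    have l2 := (c2.tendsto 0).mono_left (nhdsWithin_le_nhds (s := Ioi 0))
    have := le_of_tendsto_of_tendsto l1 l2
      (eventually_nhdsWithin_of_forall fun ε hε => key ε hε)
    simpa using this
  have hmul := mul_le_mul_of_nonneg_left lim (Real.rpow_nonneg h1.le C)
  have e3 : t₁ ^ C * t₁ ^ (-C) = 1 := by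
    rw [← Real.rpow_add h1, add_neg_cancel, Real.rpow_zero]
  rw [Real.div_rpow h1.le h0.le]
  rw [Real.rpow_neg h0.le] at hmul
  calc Real.sqrt (E t₁) = t₁ ^ C * (t₁ ^ (-C) * Real.sqrt (E t₁)) := by
        rw [← mul_assoc, e3, one_mul]
    _ ≤ _ := hmul
    _ = _ := by ring

theorem sobNorm_eq (k : ℕ) (u : ℝ → ℝ → ℝ) (t : ℝ) :
    sobNorm k (u t) = Real.sqrt (∑ j ∈ Finset.range (k + 1),
      ∫ x in (0:ℝ)..(2 * Real.pi), px^[j] u t x ^ 2) := by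
  simp only [sobNorm, iteratedDeriv_eq_iter]

theorem integral_sq_nonneg (f : ℝ → ℝ) : 0 ≤ ∫ x in (0:ℝ)..(2 * Real.pi), f x ^ 2 :=
  intervalIntegral.integral_nonneg Real.two_pi_pos.le fun _ _ => sq_nonneg _

theorem sq_sobNorm (k : ℕ) (u : ℝ → ℝ → ℝ) (t : ℝ) :
    sobNorm k (u t) ^ 2 = ∑ j ∈ Finset.range (k + 1),
      ∫ x in (0:ℝ)..(2 * Real.pi), px^[j] u t x ^ 2 := by
  rw [sobNorm_eq, Real.sq_sqrt]
  exact Finset.sum_nonneg fun j _ => integral_sq_nonneg _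

theorem sobNorm_nonneg (k : ℕ) (w : ℝ → ℝ) : 0 ≤ sobNorm k w := Real.sqrt_nonneg _

theorem sqrt_integral_sq_le_sobNorm {j k : ℕ} (hj : j ∈ Finset.range (k + 1))
    (u : ℝ → ℝ → ℝ) (t : ℝ) :
    Real.sqrt (∫ x in (0:ℝ)..(2 * Real.pi), px^[j] u t x ^ 2) ≤ sobNorm k (u t) := by
  rw [sobNorm_eq]
  exact Real.sqrt_le_sqrt (Finset.single_le_sum
    (f := fun j => ∫ x in (0:ℝ)..(2 * Real.pi), px^[j] u t x ^ 2)
    (fun j _ => integral_sq_nonneg _) hj)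

theorem continuous_sobNorm (k : ℕ) (hu : Smooth2 u) : Continuous fun t => sobNorm k (u t) := by
  simp only [sobNorm_eq]
  refine Real.continuous_sqrt.comp (continuous_finsetSum _ fun j _ => ?_)
  apply intervalIntegral.continuous_parametric_intervalIntegral_of_continuous'
  exact (continuous_uncurry (smooth2_iter hu j)).pow 2

/-- The energy of order `n` at time `t`. -/
noncomputable def energy (n : ℕ) (u : ℝ → ℝ → ℝ) (t : ℝ) : ℝ :=
  ∑ k ∈ Finset.range (n + 1), ∫ x in (0:ℝ)..(2 * Real.pi), energyDensity (px^[k] u) t x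

theorem energyDensity_ge {t : ℝ} (ht : 0 < t) (ht1 : t ≤ 1) (v : ℝ → ℝ → ℝ) (x : ℝ) :
    v t x ^ 2 + px v t x ^ 2 / 2 + t * pt v t x ^ 2 / 2 ≤ energyDensity v t x := by
  unfold energyDensity
  nlinarith [mul_nonneg ht.le (sq_nonneg (px v t x - pt v t x)),
    mul_nonneg (sub_nonneg.2 ht1) (sq_nonneg (px v t x))]

theorem energyDensity_le {t : ℝ} (ht : 0 < t) (ht1 : t ≤ 1) (v : ℝ → ℝ → ℝ) (x : ℝ) :
    energyDensity v t x ≤ v t x ^ 2 + 3 / 2 * px v t x ^ 2 + 3 / 2 * (t * pt v t x ^ 2) := by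
  unfold energyDensity
  nlinarith [mul_nonneg ht.le (sq_nonneg (px v t x + pt v t x)),
    mul_nonneg (sub_nonneg.2 ht1) (sq_nonneg (px v t x))]

theorem integral_energyDensity_ge {t : ℝ} (ht : 0 < t) (ht1 : t ≤ 1) (hv : Smooth2 v) :
    (∫ x in (0:ℝ)..(2 * Real.pi), v t x ^ 2) + (∫ x in (0:ℝ)..(2 * Real.pi), px v t x ^ 2) / 2
      + t * (∫ x in (0:ℝ)..(2 * Real.pi), pt v t x ^ 2) / 2
      ≤ ∫ x in (0:ℝ)..(2 * Real.pi), energyDensity v t x := by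
  have c1 := continuous_slice hv t
  have c2 := continuous_slice (smooth2_px hv) t
  have c3 := continuous_slice (smooth2_pt hv) t
  have c4 := continuous_slice (smooth2_energyDensity hv) t
  have h := intervalIntegral.integral_mono_on (μ := volume) Real.two_pi_pos.le
    (Continuous.intervalIntegrable (by fun_prop) _ _) (c4.intervalIntegrable _ _)
    (fun x _ => energyDensity_ge ht ht1 v x)
  rwa [intervalIntegral.integral_add, intervalIntegral.integral_add,
    intervalIntegral.integral_div, intervalIntegral.integral_div,
    intervalIntegral.integral_const_mul] at h
  all_goals exact Continuous.intervalIntegrable (by fun_prop) _ _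

theorem integral_energyDensity_le {t : ℝ} (ht : 0 < t) (ht1 : t ≤ 1) (hv : Smooth2 v) :
    ∫ x in (0:ℝ)..(2 * Real.pi), energyDensity v t x ≤
    (∫ x in (0:ℝ)..(2 * Real.pi), v t x ^ 2)
      + 3 / 2 * (∫ x in (0:ℝ)..(2 * Real.pi), px v t x ^ 2)
      + 3 / 2 * (t * (∫ x in (0:ℝ)..(2 * Real.pi), pt v t x ^ 2)) := by
  have c1 := continuous_slice hv t
  have c2 := continuous_slice (smooth2_px hv) t
  have c3 := continuous_slice (smooth2_pt hv) t
  have c4 := continuous_slice (smooth2_energyDensity hv) t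
  have h := intervalIntegral.integral_mono_on (μ := volume) Real.two_pi_pos.le
    (c4.intervalIntegrable _ _) (Continuous.intervalIntegrable (by fun_prop) _ _)
    (fun x _ => energyDensity_le ht ht1 v x)
  rwa [intervalIntegral.integral_add, intervalIntegral.integral_add,
    intervalIntegral.integral_const_mul, intervalIntegral.integral_const_mul,
    intervalIntegral.integral_const_mul] at h
  all_goals exact Continuous.intervalIntegrable (by fun_prop) _ _

theorem integral_energyDensity_nonneg {t : ℝ} (ht : 0 < t) (ht1 : t ≤ 1) (hv : Smooth2 v) :
    0 ≤ ∫ x in (0:ℝ)..(2 * Real.pi), energyDensity v t x := by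
  have h := integral_energyDensity_ge ht ht1 hv
  have h1 := integral_sq_nonneg (v t)
  have h2 := integral_sq_nonneg (px v t)
  have h3 := mul_nonneg ht.le (integral_sq_nonneg (pt v t))
  linarith

theorem energy_nonneg {t : ℝ} (ht : 0 < t) (ht1 : t ≤ 1) (n : ℕ) (hu : Smooth2 u) :
    0 ≤ energy n u t :=
  Finset.sum_nonneg fun k _ => integral_energyDensity_nonneg ht ht1 (smooth2_iter hu k)

theorem sq_sobNorm_add_le_energy {t : ℝ} (ht : 0 < t) (ht1 : t ≤ 1) (n : ℕ) (hu : Smooth2 u) :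
    sobNorm (n + 1) (u t) ^ 2 + t * sobNorm n (pt u t) ^ 2 ≤ 2 * energy n u t := by
  rw [sq_sobNorm, sq_sobNorm, Finset.sum_range_succ', energy, Finset.mul_sum, Finset.mul_sum]
  have h0 : ∫ x in (0:ℝ)..(2 * Real.pi), px^[0] u t x ^ 2 ≤
      ∑ k ∈ Finset.range (n + 1), ∫ x in (0:ℝ)..(2 * Real.pi), px^[k] u t x ^ 2 :=
    Finset.single_le_sum (f := fun k => ∫ x in (0:ℝ)..(2 * Real.pi), px^[k] u t x ^ 2)
      (fun j _ => integral_sq_nonneg _) (by simp)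
  have hk : ∀ k ∈ Finset.range (n + 1),
      (∫ x in (0:ℝ)..(2 * Real.pi), px^[k + 1] u t x ^ 2)
        + (∫ x in (0:ℝ)..(2 * Real.pi), px^[k] u t x ^ 2)
        + t * (∫ x in (0:ℝ)..(2 * Real.pi), px^[k] (pt u) t x ^ 2)
      ≤ 2 * ∫ x in (0:ℝ)..(2 * Real.pi), energyDensity (px^[k] u) t x := by
    intro k _
    have h := integral_energyDensity_ge ht ht1 (smooth2_iter hu k)
    rw [iter_pt_comm hu, Function.iterate_succ_apply']
    have h1 := integral_sq_nonneg (px^[k] u t)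
    linarith
  have hs := Finset.sum_le_sum hk
  rw [Finset.sum_add_distrib, Finset.sum_add_distrib] at hs
  linarith

theorem energy_le_sq_sobNorm_add {t : ℝ} (ht : 0 < t) (ht1 : t ≤ 1) (n : ℕ) (hu : Smooth2 u) :
    energy n u t ≤ 4 * (sobNorm (n + 1) (u t) ^ 2 + t * sobNorm n (pt u t) ^ 2) := by
  have e1 := sq_sobNorm (n + 1) u t
  have e2 := e1
  rw [Finset.sum_range_succ'] at e1
  rw [Finset.sum_range_succ] at e2
  have h0 := integral_sq_nonneg (px^[0] u t)
  have h1 := integral_sq_nonneg (px^[n + 1] u t)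
  have hk : ∀ k ∈ Finset.range (n + 1),
      ∫ x in (0:ℝ)..(2 * Real.pi), energyDensity (px^[k] u) t x ≤
      (∫ x in (0:ℝ)..(2 * Real.pi), px^[k] u t x ^ 2)
      + 3 / 2 * (∫ x in (0:ℝ)..(2 * Real.pi), px^[k + 1] u t x ^ 2)
        + 3 / 2 * (t * (∫ x in (0:ℝ)..(2 * Real.pi), px^[k] (pt u) t x ^ 2)) := by
    intro k _
    have h := integral_energyDensity_le ht ht1 (smooth2_iter hu k)
    rwa [iter_pt_comm hu, Function.iterate_succ_apply']
  have hs := Finset.sum_le_sum hk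
  rw [Finset.sum_add_distrib, Finset.sum_add_distrib, ← Finset.mul_sum, ← Finset.mul_sum,
    ← Finset.mul_sum, ← sq_sobNorm n (pt u)] at hs
  have h2 := mul_nonneg ht.le (sq_nonneg (sobNorm n (pt u t)))
  have h3 := sq_nonneg (sobNorm (n + 1) (u t))
  unfold energy
  linarith

/-- The pointwise size of all derivatives controlled by the energy of order `n`. -/
noncomputable def jetSize (n : ℕ) (u : ℝ → ℝ → ℝ) (t x : ℝ) : ℝ :=
  ∑ k ∈ Finset.range (n + 1), (|px^[k] u t x| + |px^[k] (px u) t x| + |px^[k] (pt u) t x|)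

theorem jetSize_nonneg (n : ℕ) (u : ℝ → ℝ → ℝ) (t x : ℝ) : 0 ≤ jetSize n u t x :=
  Finset.sum_nonneg fun _ _ => by positivity

theorem jetSize_mono {k n : ℕ} (h : k ≤ n) (u : ℝ → ℝ → ℝ) (t x : ℝ) :
    jetSize k u t x ≤ jetSize n u t x :=
  Finset.sum_le_sum_of_subset_of_nonneg
    (fun _ hj => Finset.mem_range.2 ((Finset.mem_range.1 hj).trans_le (by lia)))
    fun _ _ _ => by positivity

theorem jet_le_jetSize {k n : ℕ} (hk : k ∈ Finset.range (n + 1)) (u : ℝ → ℝ → ℝ) (t x : ℝ) :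
    |px^[k] u t x| + |px^[k] (px u) t x| + |px^[k] (pt u) t x| ≤ jetSize n u t x :=
  Finset.single_le_sum
    (f := fun k => |px^[k] u t x| + |px^[k] (px u) t x| + |px^[k] (pt u) t x|)
    (fun _ _ => by positivity) hk

theorem exists_bound_iter_lowerOrder {a b c : ℝ → ℝ → ℝ} (ha : Smooth2 a) (hb : Smooth2 b)
    (hc : Smooth2 c) (k : ℕ) :
    ∃ C : ℝ, 0 ≤ C ∧ ∀ u : ℝ → ℝ → ℝ, Smooth2 u → ∀ t ∈ Icc (0:ℝ) 1,
      ∀ x ∈ Icc (0:ℝ) (2 * Real.pi),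
        |px^[k] (lowerOrder a b c u) t x| ≤ C * jetSize k u t x := by
  obtain ⟨A, hA0, hA⟩ := exists_bound_iter_mul k ha
  obtain ⟨B, hB0, hB⟩ := exists_bound_iter_mul k hb
  obtain ⟨C, hC0, hC⟩ := exists_bound_iter_mul k hc
  refine ⟨1 + (A + (B + C)), by positivity, fun u hu t ht x hx => ?_⟩
  have su := hu
  have sx := smooth2_px hu
  have st := smooth2_pt hu
  have sa := smooth2_mul ha sx
  have sb := smooth2_mul hb st
  have sc := smooth2_mul hc su
  have e : px^[k] (lowerOrder a b c u) = _ := iter_add k st (smooth2_add sa (smooth2_add sb sc))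
  rw [e, iter_add k sa (smooth2_add sb sc), iter_add k sb sc]
  have h1 : |px^[k] (pt u) t x| ≤ jetSize k u t x := by
    have := jet_le_jetSize (Finset.self_mem_range_succ k) u t x
    linarith [abs_nonneg (px^[k] u t x), abs_nonneg (px^[k] (px u) t x)]
  have h2 : |px^[k] (fun t x => a t x * px u t x) t x| ≤ A * jetSize k u t x := by
    refine (hA _ sx t ht x hx).trans (mul_le_mul_of_nonneg_left (Finset.sum_le_sum fun j _ => ?_) hA0)
    linarith [abs_nonneg (px^[j] u t x), abs_nonneg (px^[j] (pt u) t x)]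
  have h3 : |px^[k] (fun t x => b t x * pt u t x) t x| ≤ B * jetSize k u t x := by
    refine (hB _ st t ht x hx).trans (mul_le_mul_of_nonneg_left (Finset.sum_le_sum fun j _ => ?_) hB0)
    linarith [abs_nonneg (px^[j] u t x), abs_nonneg (px^[j] (px u) t x)]
  have h4 : |px^[k] (fun t x => c t x * u t x) t x| ≤ C * jetSize k u t x := by
    refine (hC _ su t ht x hx).trans (mul_le_mul_of_nonneg_left (Finset.sum_le_sum fun j _ => ?_) hC0)
    linarith [abs_nonneg (px^[j] (px u) t x), abs_nonneg (px^[j] (pt u) t x)]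
  rw [add_mul, add_mul, add_mul, one_mul]
  exact (abs_add_le _ _).trans (add_le_add h1 ((abs_add_le _ _).trans (add_le_add h2
    ((abs_add_le _ _).trans (add_le_add h3 h4)))))

theorem exists_uniform_bound_iter_lowerOrder {a b c : ℝ → ℝ → ℝ} (ha : Smooth2 a)
    (hb : Smooth2 b) (hc : Smooth2 c) (n : ℕ) :
    ∃ C : ℝ, 0 ≤ C ∧ ∀ u : ℝ → ℝ → ℝ, Smooth2 u → ∀ k ∈ Finset.range (n + 1),
      ∀ t ∈ Icc (0:ℝ) 1, ∀ x ∈ Icc (0:ℝ) (2 * Real.pi),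
        |px^[k] (lowerOrder a b c u) t x| ≤ C * jetSize n u t x := by
  choose C hC0 hC using fun k => exists_bound_iter_lowerOrder ha hb hc k
  refine ⟨∑ k ∈ Finset.range (n + 1), C k, Finset.sum_nonneg fun k _ => hC0 k,
    fun u hu k hk t ht x hx => (hC k u hu t ht x hx).trans ?_⟩
  exact mul_le_mul (Finset.single_le_sum (fun k _ => hC0 k) hk)
    (jetSize_mono (by simpa [Nat.lt_succ_iff] using hk) u t x) (jetSize_nonneg _ _ _ _)
    (Finset.sum_nonneg fun k _ => hC0 k)

theorem sq_jetSize_le {t : ℝ} (ht : 0 < t) (ht1 : t ≤ 1) (n : ℕ) (hu : Smooth2 u) (x : ℝ) :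
    jetSize n u t x ^ 2 ≤ (n + 1) * (6 / t) *
      ∑ k ∈ Finset.range (n + 1), energyDensity (px^[k] u) t x := by
  have h := sq_sum_le_card_mul_sum_sq (s := Finset.range (n + 1))
    (f := fun k => |px^[k] u t x| + |px^[k] (px u) t x| + |px^[k] (pt u) t x|)
  rw [Finset.card_range] at h
  push_cast at h
  refine h.trans ?_
  rw [mul_assoc]
  refine mul_le_mul_of_nonneg_left ?_ (by positivity)
  rw [Finset.mul_sum]
  refine Finset.sum_le_sum fun k _ => ?_
  have he := energyDensity_ge ht ht1 (px^[k] u) x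
  rw [iter_pt_comm hu, ← Function.iterate_succ_apply, Function.iterate_succ_apply']
  set p := px^[k] u t x
  set q := px (px^[k] u) t x
  set r := pt (px^[k] u) t x
  rw [div_mul_eq_mul_div, le_div_iff₀ ht]
  have h1 : (|p| + |q| + |r|) ^ 2 ≤ 3 * (p ^ 2 + q ^ 2 + r ^ 2) := by
    rw [← sq_abs p, ← sq_abs q, ← sq_abs r]
    nlinarith [sq_nonneg (|p| - |q|), sq_nonneg (|p| - |r|), sq_nonneg (|q| - |r|)]
  have h2 : t * p ^ 2 ≤ p ^ 2 := mul_le_of_le_one_left (sq_nonneg _) ht1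
  have h3 : t * q ^ 2 ≤ q ^ 2 := mul_le_of_le_one_left (sq_nonneg _) ht1
  have h4 := mul_le_mul_of_nonneg_right h1 ht.le
  nlinarith [sq_nonneg p]

/-- The part of the energy flux that does not involve the full wave operator. -/
theorem energyFlux_le {C : ℝ} {n k : ℕ} {f : ℝ → ℝ → ℝ} {t x : ℝ} (hu : Smooth2 u)
    (hk : k ∈ Finset.range (n + 1)) (hf : |f t x| ≤ C * jetSize n u t x) :
    energyFlux (px^[k] u) (fun t x => - f t x) t x ≤ (4 + 3 * C) * jetSize n u t x ^ 2 := by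
  have hj := jet_le_jetSize hk u t x
  rw [iter_pt_comm hu, ← Function.iterate_succ_apply, Function.iterate_succ_apply'] at hj
  unfold energyFlux
  set p := px^[k] u t x
  set q := px (px^[k] u) t x
  set r := pt (px^[k] u) t x
  set T := jetSize n u t x
  have hp := abs_nonneg p
  have hq := abs_nonneg q
  have hr := abs_nonneg r
  have hT : 0 ≤ T := jetSize_nonneg _ _ _ _
  have h1 : p * r ≤ T * T := (le_abs_self _).trans
    (by rw [abs_mul]; exact mul_le_mul (by linarith) (by linarith) hr hT)
  have h2 : -(q * r) ≤ T * T := (neg_le_abs _).trans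
    (by rw [abs_mul]; exact mul_le_mul (by linarith) (by linarith) hr hT)
  have h3 : r * r ≤ T * T := (le_abs_self _).trans
    (by rw [abs_mul]; exact mul_le_mul (by linarith) (by linarith) hr hT)
  have h4 : |2 * r - q| ≤ 3 * T := by
    have := abs_sub (2 * r) q
    rw [abs_mul, abs_two] at this
    linarith
  have h5 : (2 * r - q) * (- f t x) ≤ (3 * T) * (C * T) := (le_abs_self _).trans
    (by rw [abs_mul, abs_neg]; exact mul_le_mul h4 hf (abs_nonneg _) (by positivity))
  nlinarith

theorem hasDerivAt_energy_sum (n : ℕ) (hu : Smooth2 u) (hp : Periodic2 u) (t : ℝ) :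
    HasDerivAt (energy n u) (∑ k ∈ Finset.range (n + 1), ∫ x in (0:ℝ)..(2 * Real.pi),
      energyFlux (px^[k] u) (principal (px^[k] u)) t x) t :=
  HasDerivAt.fun_sum fun k _ => hasDerivAt_energy (smooth2_iter hu k) (periodic2_iter hp k) t

theorem integral_forcing_le {t : ℝ} (ht : 0 < t) (ht1 : t ≤ 1) {n k : ℕ}
    (hk : k ∈ Finset.range (n + 1)) (hu : Smooth2 u) {f : ℝ → ℝ → ℝ} (hf : Smooth2 f) :
    ∫ x in (0:ℝ)..(2 * Real.pi),
      (2 * pt (px^[k] u) t x - px (px^[k] u) t x) * px^[k] f t x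
      ≤ 4 * t ^ (-(1/2) : ℝ) * (Real.sqrt (energy n u t) * sobNorm n (f t)) := by
  have hv := smooth2_iter hu k
  have c2 := continuous_slice (smooth2_px hv) t
  have c3 := continuous_slice (smooth2_pt hv) t
  have c4 := continuous_slice (smooth2_energyDensity hv) t
  refine (integral_mul_le_sqrt_mul_sqrt (by fun_prop) (continuous_slice (smooth2_iter hf k) t)
    Real.two_pi_pos.le).trans ?_
  rw [← mul_assoc]
  refine mul_le_mul ?_ (sqrt_integral_sq_le_sobNorm hk f t) (Real.sqrt_nonneg _) (by positivity)
  have hle : ∫ x in (0:ℝ)..(2 * Real.pi), (2 * pt (px^[k] u) t x - px (px^[k] u) t x) ^ 2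
      ≤ 16 / t * energy n u t := by
    have h1 : ∫ x in (0:ℝ)..(2 * Real.pi), (2 * pt (px^[k] u) t x - px (px^[k] u) t x) ^ 2
        ≤ ∫ x in (0:ℝ)..(2 * Real.pi), 16 / t * energyDensity (px^[k] u) t x := by
      refine intervalIntegral.integral_mono_on (μ := volume) Real.two_pi_pos.le
        (Continuous.intervalIntegrable (by fun_prop) _ _)
        (Continuous.intervalIntegrable (by fun_prop) _ _) fun x _ => ?_
      have he := energyDensity_ge ht ht1 (px^[k] u) x
      set p := px^[k] u t x
      set q := px (px^[k] u) t x
      set r := pt (px^[k] u) t x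
      rw [div_mul_eq_mul_div, le_div_iff₀ ht]
      have h3 : t * q ^ 2 ≤ q ^ 2 := mul_le_of_le_one_left (sq_nonneg _) ht1
      have h4 : (2 * r - q) ^ 2 * t ≤ (8 * r ^ 2 + 8 * q ^ 2) * t :=
        mul_le_mul_of_nonneg_right
          (by nlinarith [sq_nonneg (r + q), sq_nonneg r, sq_nonneg q]) ht.le
      nlinarith [sq_nonneg p]
    rw [intervalIntegral.integral_const_mul] at h1
    refine h1.trans (mul_le_mul_of_nonneg_left ?_ (by positivity))
    exact Finset.single_le_sum
      (f := fun k => ∫ x in (0:ℝ)..(2 * Real.pi), energyDensity (px^[k] u) t x)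
      (fun j _ => integral_energyDensity_nonneg ht ht1 (smooth2_iter hu j)) hk
  refine (Real.sqrt_le_sqrt hle).trans (le_of_eq ?_)
  have e16 : Real.sqrt 16 = 4 := by
    rw [show (16:ℝ) = 4 ^ 2 by norm_num]; exact Real.sqrt_sq (by norm_num)
  rw [Real.sqrt_mul (by positivity), Real.sqrt_div (by norm_num), e16, Real.rpow_neg ht.le,
    ← Real.sqrt_eq_rpow, div_eq_mul_inv]

/-- The differential inequality satisfied by the energy near the Cauchy horizon. -/
theorem exists_deriv_energy_le {a b c : ℝ → ℝ → ℝ} (ha : Smooth2 a) (hb : Smooth2 b)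
    (hc : Smooth2 c) (n : ℕ) :
    ∃ C : ℝ, 0 ≤ C ∧ ∀ u : ℝ → ℝ → ℝ, Smooth2 u → ∀ t : ℝ, 0 < t → t ≤ 1 →
      (∑ k ∈ Finset.range (n + 1), ∫ x in (0:ℝ)..(2 * Real.pi),
        energyFlux (px^[k] u) (principal (px^[k] u)) t x)
      ≤ C / t * energy n u t + (4 * (n + 1)) * t ^ (-(1/2) : ℝ) *
          (Real.sqrt (energy n u t) * sobNorm n (MisnerP a b c u t)) := by
  obtain ⟨C, hC0, hC⟩ := exists_uniform_bound_iter_lowerOrder ha hb hc n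
  refine ⟨(n + 1) * ((4 + 3 * C) * ((n + 1) * 6)), by positivity, fun u hu t ht ht1 => ?_⟩
  have sL := smooth2_lowerOrder ha hb hc hu
  have sP : Smooth2 (MisnerP a b c u) := by
    rw [misnerP_eq]; exact smooth2_add (smooth2_principal hu) sL
  have hflux : ∀ k x, energyFlux (px^[k] u) (principal (px^[k] u)) t x
      = energyFlux (px^[k] u) (fun t x => - px^[k] (lowerOrder a b c u) t x) t x
        + (2 * pt (px^[k] u) t x - px (px^[k] u) t x) * px^[k] (MisnerP a b c u) t x := by
    intro k x
    rw [misnerP_eq, iter_add k (smooth2_principal hu) sL, iter_principal hu]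
    simp only [energyFlux]
    ring
  have sF : ∀ k, Smooth2
      (energyFlux (px^[k] u) (fun t x => - px^[k] (lowerOrder a b c u) t x)) := fun k =>
    smooth2_energyFlux (smooth2_iter hu k) (ContDiff.neg (smooth2_iter sL k))
  have hsplit : ∀ k ∈ Finset.range (n + 1), ∫ x in (0:ℝ)..(2 * Real.pi),
      energyFlux (px^[k] u) (principal (px^[k] u)) t x ≤
        (4 + 3 * C) * ((n + 1) * 6) / t * energy n u t + 4 * t ^ (-(1/2) : ℝ) *
          (Real.sqrt (energy n u t) * sobNorm n (MisnerP a b c u t)) := by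
    intro k hk
    have c1 := continuous_slice (smooth2_px (smooth2_iter hu k)) t
    have c2 := continuous_slice (smooth2_pt (smooth2_iter hu k)) t
    have c3 := continuous_slice (smooth2_iter sP k) t
    have c4 : ∀ j, Continuous (energyDensity (px^[j] u) t) := fun j =>
      continuous_slice (smooth2_energyDensity (smooth2_iter hu j)) t
    simp only [hflux]
    rw [intervalIntegral.integral_add (intervalIntegrable_slice (sF k) t _ _)
      (Continuous.intervalIntegrable (by fun_prop) _ _)]
    refine add_le_add ?_ (integral_forcing_le ht ht1 hk hu sP)
    have hmono := intervalIntegral.integral_mono_on (μ := volume) Real.two_pi_pos.le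
      (intervalIntegrable_slice (sF k) t _ _)
      (g := fun x => (4 + 3 * C) * ((n + 1) * 6) / t *
        ∑ j ∈ Finset.range (n + 1), energyDensity (px^[j] u) t x)
      (Continuous.intervalIntegrable
        (continuous_const.mul (continuous_finsetSum _ fun j _ => c4 j)) _ _) (fun x hx => by
          refine (energyFlux_le hu hk (hC u hu k hk t ⟨ht.le, ht1⟩ x hx)).trans ?_
          refine (mul_le_mul_of_nonneg_left (sq_jetSize_le ht ht1 n hu x)
            (by positivity)).trans (le_of_eq ?_)
          ring)
    rwa [intervalIntegral.integral_const_mul, intervalIntegral.integral_finsetSum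
      (fun j _ => (c4 j).intervalIntegrable _ _)] at hmono
  refine (Finset.sum_le_sum hsplit).trans (le_of_eq ?_)
  rw [Finset.sum_const, Finset.card_range, nsmul_eq_mul]
  push_cast
  ring

end Misner

/-- The energy estimate close to the compact Cauchy horizon of the Misner
spacetime (Theorem 3.1 of the paper). -/
theorem stmt5 (a b c : ℝ → ℝ → ℝ)
    (ha : Smooth2 a) (hap : Periodic2 a)
    (hb : Smooth2 b) (hbp : Periodic2 b)
    (hc : Smooth2 c) (hcp : Periodic2 c)
    (m : ℕ) :
    ∃ D : ℝ, 0 < D ∧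
      ∀ t₀ t₁ : ℝ, 0 < t₀ → t₀ ≤ t₁ → t₁ ≤ 1 →
        ∀ u : ℝ → ℝ → ℝ, Smooth2 u → Periodic2 u →
          sobNorm (2 * m + 1) (u t₁) + Real.sqrt t₁ * sobNorm (2 * m) (pt u t₁)
            ≤ D * (t₁ / t₀) ^ D *
                (sobNorm (2 * m + 1) (u t₀) + Real.sqrt t₀ * sobNorm (2 * m) (pt u t₀))
              + D * t₁ ^ D *
                ∫ t in t₀..t₁,
                  sobNorm (2 * m) (fun x => MisnerP a b c u t x) * t ^ (-D - 1/2) := by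
  obtain ⟨C, hC0, hC⟩ := Misner.exists_deriv_energy_le ha hb hc (2 * m)
  set N : ℝ := ((2 * m : ℕ) : ℝ) with hN
  have hN0 : 0 ≤ N := Nat.cast_nonneg _
  set K : ℝ := 2 * (N + 1) with hK
  have hK0 : 0 ≤ K := by positivity
  set D : ℝ := C + 3 * K + 6 with hD
  refine ⟨D, by positivity, fun t₀ t₁ h0 h01 h1 u hu hp => ?_⟩
  have h1p : 0 < t₁ := h0.trans_le h01
  have sP : Smooth2 (MisnerP a b c u) := by
    rw [Misner.misnerP_eq]
    exact Misner.smooth2_add (Misner.smooth2_principal hu)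
      (Misner.smooth2_lowerOrder ha hb hc hu)
  have hE0 : ∀ t, 0 < t → t ≤ t₁ → 0 ≤ Misner.energy (2 * m) u t := fun t ht ht1 =>
    Misner.energy_nonneg ht (ht1.trans h1) _ hu
  have hgr := Misner.sqrt_gronwall (C := D) (K := K) h0 h01 (by positivity) hK0 hE0
    (Misner.hasDerivAt_energy_sum (2 * m) hu hp) (Misner.continuous_sobNorm (2 * m) sP)
    (fun t => Misner.sobNorm_nonneg _ _) (fun t ht ht1 => by
      refine (hC u hu t ht (ht1.trans h1)).trans (add_le_add ?_ (le_of_eq ?_))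
      · exact mul_le_mul_of_nonneg_right
          (div_le_div_of_nonneg_right (by linarith) ht.le) (hE0 t ht ht1)
      · rw [hK]; ring)
  have hn : ∀ t, 0 ≤ sobNorm (2 * m + 1) (u t) := fun t => Misner.sobNorm_nonneg _ _
  have hn' : ∀ t, 0 ≤ Real.sqrt t * sobNorm (2 * m) (pt u t) := fun t =>
    mul_nonneg (Real.sqrt_nonneg _) (Misner.sobNorm_nonneg _ _)
  have hsq : ∀ t, 0 < t → (Real.sqrt t * sobNorm (2 * m) (pt u t)) ^ 2
      = t * sobNorm (2 * m) (pt u t) ^ 2 := fun t ht => by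
    rw [mul_pow, Real.sq_sqrt ht.le]
  have hupper : sobNorm (2 * m + 1) (u t₁) + Real.sqrt t₁ * sobNorm (2 * m) (pt u t₁)
      ≤ 3 * Real.sqrt (Misner.energy (2 * m) u t₁) := by
    have hs := Misner.sq_sobNorm_add_le_energy h1p h1 (2 * m) hu
    rw [← hsq t₁ h1p] at hs
    have hq := Real.sq_sqrt (hE0 t₁ h1p le_rfl)
    refine abs_le_of_sq_le_sq' (b := 3 * Real.sqrt (Misner.energy (2 * m) u t₁)) ?_
      (by positivity) |>.2
    nlinarith [sq_nonneg (sobNorm (2 * m + 1) (u t₁)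
      - Real.sqrt t₁ * sobNorm (2 * m) (pt u t₁)), hE0 t₁ h1p le_rfl]
  have hlower : Real.sqrt (Misner.energy (2 * m) u t₀)
      ≤ 2 * (sobNorm (2 * m + 1) (u t₀) + Real.sqrt t₀ * sobNorm (2 * m) (pt u t₀)) := by
    have hs := Misner.energy_le_sq_sobNorm_add h0 (h01.trans h1) (2 * m) hu
    rw [← hsq t₀ h0] at hs
    refine Real.sqrt_le_iff.2 ⟨by linarith [hn t₀, hn' t₀], hs.trans ?_⟩
    nlinarith [mul_nonneg (hn t₀) (hn' t₀)]
  have hint : 0 ≤ ∫ t in t₀..t₁, sobNorm (2 * m) (MisnerP a b c u t) * t ^ (-D - 1/2) :=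
    intervalIntegral.integral_nonneg h01 fun t ht =>
      mul_nonneg (Misner.sobNorm_nonneg _ _) (Real.rpow_nonneg (h0.le.trans ht.1) _)
  have hr : 0 ≤ (t₁ / t₀) ^ D := by positivity
  have hr1 : 0 ≤ t₁ ^ D := by positivity
  refine hupper.trans ((mul_le_mul_of_nonneg_left hgr (by norm_num)).trans ?_)
  rw [mul_add]
  refine add_le_add ?_ ?_
  · calc 3 * ((t₁ / t₀) ^ D * Real.sqrt (Misner.energy (2 * m) u t₀))
        ≤ 3 * ((t₁ / t₀) ^ D *
          (2 * (sobNorm (2 * m + 1) (u t₀) + Real.sqrt t₀ * sobNorm (2 * m) (pt u t₀)))) := by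
          gcongr
      _ = 6 * ((t₁ / t₀) ^ D *
          (sobNorm (2 * m + 1) (u t₀) + Real.sqrt t₀ * sobNorm (2 * m) (pt u t₀))) := by ring
      _ ≤ D * ((t₁ / t₀) ^ D *
          (sobNorm (2 * m + 1) (u t₀) + Real.sqrt t₀ * sobNorm (2 * m) (pt u t₀))) :=
          mul_le_mul_of_nonneg_right (by linarith)
            (mul_nonneg hr (add_nonneg (hn t₀) (hn' t₀)))
      _ = _ := by ring
  · rw [← mul_assoc, ← mul_assoc]
    refine mul_le_mul_of_nonneg_right (mul_le_mul_of_nonneg_right ?_ hr1) hint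
    linarith
end

section
/- Let n ≥ 1, v ∈ ℝⁿ, let α : ℝⁿ → ℝ be smooth, ℤⁿ-periodic, and satisfy α(x) ≥ c for all x for some constant c > 0, and let f : ℝⁿ → ℝ be smooth and ℤⁿ-periodic. Then the formula u(x) := ∫_{−∞}^0 exp(−∫_s^0 α(x + a·v) da) · f(x + s·v) ds defines a function u : ℝⁿ → ℝ (the integral converges absolutely) which is smooth, ℤⁿ-periodic, and satisfies Du(x)(v) + α(x)·u(x) = f(x) for every x ∈ ℝⁿ. -/
open MeasureTheory

/-- `ℤⁿ`-periodicity: the function descends to the flat torus `ℝⁿ/ℤⁿ`. -/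
def ZPeriodic {n : ℕ} (g : (Fin n → ℝ) → ℝ) : Prop :=
  ∀ (x : Fin n → ℝ) (k : Fin n → ℤ), g (x + fun i => (k i : ℝ)) = g x

/-- The integrand of the flow-integral formula. -/
noncomputable def flowIntegrand {n : ℕ} (v : Fin n → ℝ) (α f : (Fin n → ℝ) → ℝ)
    (x : Fin n → ℝ) (s : ℝ) : ℝ :=
  Real.exp (-(∫ a in s..(0:ℝ), α (x + a • v))) * f (x + s • v)

/-- The solution of `∂_v u + α u = f` on the torus, defined by integrating `f`
along the backward flow of the constant vector field `v` with exponential weight. -/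
noncomputable def flowSol {n : ℕ} (v : Fin n → ℝ) (α f : (Fin n → ℝ) → ℝ) :
    (Fin n → ℝ) → ℝ :=
  fun x => ∫ s in Set.Iic (0:ℝ), flowIntegrand v α f x s

open Filter Topology

namespace ZPeriodic

variable {n : ℕ} {g h : (Fin n → ℝ) → ℝ}

lemma mul (hg : ZPeriodic g) (hh : ZPeriodic h) : ZPeriodic fun x => g x * h x := fun x k => by
  simp only [hg x k, hh x k]

lemma fderiv_add (hg : ZPeriodic g) (x : Fin n → ℝ) (k : Fin n → ℤ) :
    fderiv ℝ g (x + fun i => (k i : ℝ)) = fderiv ℝ g x := by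
  rw [← fderiv_comp_add_right]
  congr 1
  exact funext fun y => hg y k

lemma fderiv_apply (hg : ZPeriodic g) (w : Fin n → ℝ) : ZPeriodic fun x => fderiv ℝ g x w :=
  fun x k => by simp only [hg.fderiv_add x k]

lemma exists_bound (hg : ZPeriodic g) (hc : Continuous g) : ∃ C, ∀ x, |g x| ≤ C := by
  obtain ⟨C, hC⟩ := (isCompact_Icc (a := (0 : Fin n → ℝ)) (b := 1)).exists_bound_of_continuousOn
    hc.continuousOn
  refine ⟨C, fun x => ?_⟩
  have hx : g (fun i => Int.fract (x i)) = g x := by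
    rw [← hg _ fun i => ⌊x i⌋]
    congr 1
    exact funext fun i => Int.fract_add_floor (x i)
  rw [← hx]
  exact hC _ ⟨fun i => Int.fract_nonneg _, fun i => (Int.fract_lt_one _).le⟩

lemma exists_bound_fderiv (hg : ZPeriodic g) (hc : ContDiff ℝ 1 g) :
    ∃ C, ∀ x, ‖fderiv ℝ g x‖ ≤ C := by
  have hp : ZPeriodic fun x => ‖fderiv ℝ g x‖ := fun x k => by simp only [hg.fderiv_add x k]
  simpa using hp.exists_bound (hc.continuous_fderiv one_ne_zero).norm

end ZPeriodic

lemma abs_mul_exp_mul_le {c s : ℝ} (hc : 0 < c) (hs : s ≤ 0) :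
    |s| * Real.exp (c * s) ≤ 2 / c * Real.exp (c / 2 * s) := by
  have h1 : -(c / 2 * s) ≤ Real.exp (-(c / 2 * s)) := by
    linarith [Real.add_one_le_exp (-(c / 2 * s))]
  have h2 : Real.exp (c * s) = Real.exp (c / 2 * s) * Real.exp (c / 2 * s) := by
    rw [← Real.exp_add]; ring_nf
  have h3 : |s| = 2 / c * -(c / 2 * s) := by
    rw [abs_of_nonpos hs]; field_simp
  calc |s| * Real.exp (c * s)
      ≤ 2 / c * Real.exp (-(c / 2 * s)) * Real.exp (c * s) := by rw [h3]; gcongr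
    _ = 2 / c * Real.exp (c / 2 * s) := by
        rw [mul_assoc, ← Real.exp_add]; ring_nf

section Orbit

variable {n : ℕ} {E : Type*} [NormedAddCommGroup E] [NormedSpace ℝ E] (v : Fin n → ℝ)

lemma continuous_integral_orbit {g : (Fin n → ℝ) → E} (hg : Continuous g) :
    Continuous fun p : (Fin n → ℝ) × ℝ => ∫ a in p.2..(0:ℝ), g (p.1 + a • v) := by
  simp_rw [fun p : (Fin n → ℝ) × ℝ =>
    intervalIntegral.integral_symm (f := fun a => g (p.1 + a • v)) (μ := volume) 0 p.2]
  refine (intervalIntegral.continuous_parametric_intervalIntegral_of_continuous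
    (f := fun (p : (Fin n → ℝ) × ℝ) a => g (p.1 + a • v)) ?_ continuous_snd).neg
  unfold Function.uncurry
  fun_prop

lemma norm_integral_orbit_le {g : (Fin n → ℝ) → E} {C : ℝ} (hC : ∀ x, ‖g x‖ ≤ C)
    (x : Fin n → ℝ) (s : ℝ) : ‖∫ a in s..(0:ℝ), g (x + a • v)‖ ≤ C * |s| := by
  simpa using intervalIntegral.norm_integral_le_of_norm_le_const (a := s) (b := 0)
    fun a _ => hC (x + a • v)

lemma hasDerivAt_integral_orbit [CompleteSpace E] {g : (Fin n → ℝ) → E} (hg : Continuous g)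
    (x : Fin n → ℝ) (s : ℝ) :
    HasDerivAt (fun s => ∫ a in s..(0:ℝ), g (x + a • v)) (-g (x + s • v)) s := by
  have h : Continuous fun a : ℝ => g (x + a • v) := by fun_prop
  exact intervalIntegral.integral_hasDerivAt_left (h.intervalIntegrable _ _)
    h.stronglyMeasurable.stronglyMeasurableAtFilter h.continuousAt

lemma hasFDerivAt_integral_orbit {g : (Fin n → ℝ) → ℝ} (hg : ContDiff ℝ 1 g)
    (hgp : ZPeriodic g) (x : Fin n → ℝ) (s : ℝ) :
    HasFDerivAt (fun x => ∫ a in s..(0:ℝ), g (x + a • v))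
      (∫ a in s..(0:ℝ), fderiv ℝ g (x + a • v)) x := by
  obtain ⟨C, hC⟩ := hgp.exists_bound_fderiv hg
  have h0 := hg.continuous
  have h1 := hg.continuous_fderiv one_ne_zero
  have hc : ∀ x, Continuous fun a : ℝ => g (x + a • v) := fun x => by fun_prop
  have hc' : Continuous fun a : ℝ => fderiv ℝ g (x + a • v) := by fun_prop
  refine intervalIntegral.hasFDerivAt_integral_of_dominated_of_fderiv_le
    (F := fun x a => g (x + a • v)) (F' := fun x a => fderiv ℝ g (x + a • v))
    (bound := fun _ => C) univ_mem (.of_forall fun x => (hc x).aestronglyMeasurable)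
    ((hc x).intervalIntegrable _ _) hc'.aestronglyMeasurable
    (.of_forall fun a _ y _ => hC _) (by simp) (.of_forall fun a _ y _ => ?_)
  exact (hasFDerivAt_comp_add_right _).2 (hg.differentiable one_ne_zero _).hasFDerivAt

end Orbit

section FlowSol

variable {n : ℕ} {v : Fin n → ℝ} {α f : (Fin n → ℝ) → ℝ} {c : ℝ}

lemma continuous_flowIntegrand (hα : Continuous α) (hf : Continuous f) :
    Continuous fun p : (Fin n → ℝ) × ℝ => flowIntegrand v α f p.1 p.2 := by
  have := continuous_integral_orbit v hα
  unfold flowIntegrand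
  fun_prop

lemma exp_neg_integral_orbit_le (hα : Continuous α) (hαc : ∀ x, c ≤ α x) (x : Fin n → ℝ)
    {s : ℝ} (hs : s ≤ 0) :
    Real.exp (-(∫ a in s..(0:ℝ), α (x + a • v))) ≤ Real.exp (c * s) := by
  have h : Continuous fun a : ℝ => α (x + a • v) := by fun_prop
  have := intervalIntegral.integral_mono_on (μ := volume) hs
    (continuous_const (y := c).intervalIntegrable _ _) (h.intervalIntegrable _ _)
    fun a _ => hαc (x + a • v)
  simp only [intervalIntegral.integral_const, smul_eq_mul] at this
  gcongr
  linarith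

lemma abs_flowIntegrand_le (hα : Continuous α) (hαc : ∀ x, c ≤ α x) {C : ℝ}
    (hC : ∀ x, |f x| ≤ C) (x : Fin n → ℝ) {s : ℝ} (hs : s ≤ 0) :
    |flowIntegrand v α f x s| ≤ Real.exp (c * s) * C := by
  rw [flowIntegrand, abs_mul, Real.abs_exp]
  exact mul_le_mul (exp_neg_integral_orbit_le hα hαc x hs) (hC _) (abs_nonneg _)
    (Real.exp_pos _).le

lemma norm_flowIntegrand_smul_integral_orbit_le {E : Type*} [NormedAddCommGroup E]
    [NormedSpace ℝ E] {g : (Fin n → ℝ) → E} {B C : ℝ} (hα : Continuous α) (hc : 0 < c)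
    (hαc : ∀ x, c ≤ α x) (hC : ∀ x, |f x| ≤ C) (hB : ∀ x, ‖g x‖ ≤ B) (x : Fin n → ℝ) {s : ℝ}
    (hs : s ≤ 0) :
    ‖flowIntegrand v α f x s • ∫ a in s..(0:ℝ), g (x + a • v)‖ ≤
      C * B * (2 / c) * Real.exp (c / 2 * s) := by
  have hC0 : 0 ≤ C := (abs_nonneg _).trans (hC 0)
  have hB0 : 0 ≤ B := (norm_nonneg _).trans (hB 0)
  rw [norm_smul]
  calc _ ≤ Real.exp (c * s) * C * (B * |s|) :=
        mul_le_mul (abs_flowIntegrand_le hα hαc hC x hs) (norm_integral_orbit_le v hB x s)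
          (norm_nonneg _) (by positivity)
    _ = C * B * (|s| * Real.exp (c * s)) := by ring
    _ ≤ C * B * (2 / c * Real.exp (c / 2 * s)) :=
        mul_le_mul_of_nonneg_left (abs_mul_exp_mul_le hc hs) (by positivity)
    _ = _ := by ring

lemma integrableOn_flowIntegrand (hα : Continuous α) (hc : 0 < c) (hαc : ∀ x, c ≤ α x)
    (hf : Continuous f) (hfp : ZPeriodic f) (x : Fin n → ℝ) :
    IntegrableOn (flowIntegrand v α f x) (Set.Iic (0:ℝ)) := by
  obtain ⟨C, hC⟩ := hfp.exists_bound hf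
  refine ((integrableOn_exp_mul_Iic hc 0).mul_const C).mono'
    ((continuous_flowIntegrand hα hf).comp (.prodMk_right x)).aestronglyMeasurable ?_
  exact (ae_restrict_mem measurableSet_Iic).mono fun s hs => abs_flowIntegrand_le hα hαc hC x hs

lemma continuous_flowSol (hα : Continuous α) (hc : 0 < c) (hαc : ∀ x, c ≤ α x)
    (hf : Continuous f) (hfp : ZPeriodic f) : Continuous (flowSol v α f) := by
  obtain ⟨C, hC⟩ := hfp.exists_bound hf
  refine continuous_of_dominated
    (fun x => ((continuous_flowIntegrand hα hf).comp (.prodMk_right x)).aestronglyMeasurable)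
    (fun x => ?_) ((integrableOn_exp_mul_Iic hc 0).mul_const C)
    (.of_forall fun s => (continuous_flowIntegrand hα hf).comp (.prodMk_left s))
  exact (ae_restrict_mem measurableSet_Iic).mono fun s hs => abs_flowIntegrand_le hα hαc hC x hs

lemma ZPeriodic.flowSol (hαp : ZPeriodic α) (hfp : ZPeriodic f) :
    ZPeriodic (flowSol v α f) := fun x k => by
  have h {g : (Fin n → ℝ) → ℝ} (hg : ZPeriodic g) (a : ℝ) :
      g ((x + fun i => (k i : ℝ)) + a • v) = g (x + a • v) := by
    rw [add_right_comm, hg]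
  simp only [_root_.flowSol, flowIntegrand, h hαp, h hfp]

/-- The cocycle property of the weighted integrand along the flow. -/
lemma flowIntegrand_add (hα : Continuous α) (x : Fin n → ℝ) (r s : ℝ) :
    flowIntegrand v α f x (r + s) =
      Real.exp (-(∫ a in s..(0:ℝ), α (x + a • v))) * flowIntegrand v α f (x + s • v) r := by
  have h : Continuous fun a : ℝ => α (x + a • v) := by fun_prop
  have h1 : ∫ a in r..(0:ℝ), α (x + s • v + a • v) = ∫ a in (r + s)..s, α (x + a • v) := by
    have := intervalIntegral.integral_comp_add_right (a := r) (b := 0)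
      (fun a => α (x + a • v)) s
    rw [zero_add] at this
    rw [← this]
    simp only [add_smul, add_assoc, add_comm (s • v)]
  rw [flowIntegrand, flowIntegrand, h1, ← mul_assoc, ← Real.exp_add, ← neg_add,
    add_comm (∫ a in s..(0:ℝ), _), intervalIntegral.integral_add_adjacent_intervals
      (h.intervalIntegrable _ _) (h.intervalIntegrable _ _)]
  simp only [add_smul, add_assoc, add_comm (s • v)]

lemma flowIntegrand_flowSol (hα : Continuous α) (x : Fin n → ℝ) (s : ℝ) :
    flowIntegrand v α (flowSol v α f) x s = ∫ r in Set.Iic s, flowIntegrand v α f x r := by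
  have h := (measurePreserving_add_right volume s).setIntegral_preimage_emb
    (measurableEmbedding_addRight s) (flowIntegrand v α f x) (Set.Iic s)
  rw [← h, show (fun r => r + s) ⁻¹' Set.Iic s = Set.Iic 0 by ext; simp]
  simp only [flowIntegrand_add hα, integral_const_mul]
  rfl

lemma hasDerivAt_flowIntegrand_flowSol (hα : Continuous α) (hc : 0 < c) (hαc : ∀ x, c ≤ α x)
    (hf : Continuous f) (hfp : ZPeriodic f) (x : Fin n → ℝ) (s : ℝ) :
    HasDerivAt (flowIntegrand v α (flowSol v α f) x) (flowIntegrand v α f x s) s := by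
  have hF : Continuous (flowIntegrand v α f x) :=
    (continuous_flowIntegrand hα hf).comp (.prodMk_right x)
  have h0 := integrableOn_flowIntegrand (v := v) hα hc hαc hf hfp x
  have hI (b : ℝ) : IntegrableOn (flowIntegrand v α f x) (Set.Iic b) :=
    (h0.union (hF.integrableOn_Icc (a := 0) (b := b))).mono_set fun t ht =>
      (le_total t 0).imp id fun h => ⟨h, ht⟩
  have hG : flowIntegrand v α (flowSol v α f) x =
      fun s => flowSol v α f x + ∫ r in (0:ℝ)..s, flowIntegrand v α f x r := by
    funext s
    rw [flowIntegrand_flowSol hα, ← intervalIntegral.integral_Iic_sub_Iic h0 (hI s), flowSol]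
    ring
  rw [hG]
  exact (hF.integral_hasStrictDerivAt 0 s).hasDerivAt.const_add _

/-- Integration by parts along the flow. -/
lemma integral_flowIntegrand_mul (hα : Continuous α) (hc : 0 < c) (hαc : ∀ x, c ≤ α x)
    (hαp : ZPeriodic α) (hf : Continuous f) (hfp : ZPeriodic f) {β : (Fin n → ℝ) → ℝ}
    (hβ : Continuous β) (hβp : ZPeriodic β) (x : Fin n → ℝ) :
    IntegrableOn (fun s => flowIntegrand v α f x s * ∫ a in s..(0:ℝ), β (x + a • v))
      (Set.Iic 0) ∧
    ∫ s in Set.Iic (0:ℝ), flowIntegrand v α f x s * ∫ a in s..(0:ℝ), β (x + a • v) =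
      flowSol v α (fun y => β y * flowSol v α f y) x := by
  obtain ⟨B, hB⟩ := hβp.exists_bound hβ
  have hu := continuous_flowSol (v := v) hα hc hαc hf hfp
  have hup : ZPeriodic (flowSol v α f) := hαp.flowSol hfp
  obtain ⟨C, hC⟩ := hfp.exists_bound hf
  obtain ⟨D, hD⟩ := hup.exists_bound hu
  have hint : IntegrableOn
      (fun s => flowIntegrand v α f x s * ∫ a in s..(0:ℝ), β (x + a • v)) (Set.Iic 0) := by
    refine ((integrableOn_exp_mul_Iic (half_pos hc) 0).const_mul (C * B * (2 / c))).mono'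
      (((continuous_flowIntegrand hα hf).comp (.prodMk_right x)).mul
        ((continuous_integral_orbit v hβ).comp (.prodMk_right x))).aestronglyMeasurable ?_
    exact (ae_restrict_mem measurableSet_Iic).mono fun s hs =>
      norm_flowIntegrand_smul_integral_orbit_le hα hc hαc hC hB x hs
  have hint' : IntegrableOn (flowIntegrand v α (fun y => β y * flowSol v α f y) x)
      (Set.Iic 0) :=
    integrableOn_flowIntegrand (v := v) hα hc hαc (hβ.mul hu) (hβp.mul hup) x
  have htend : Tendsto (fun s => flowIntegrand v α (flowSol v α f) x s *
      ∫ a in s..(0:ℝ), β (x + a • v)) atBot (𝓝 0) := by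
    refine squeeze_zero_norm' ((eventually_le_atBot 0).mono fun s hs =>
      norm_flowIntegrand_smul_integral_orbit_le hα hc hαc hD hB x hs) ?_
    simpa using (Real.tendsto_exp_atBot.comp
      (tendsto_id.const_mul_atBot (half_pos hc))).const_mul (D * B * (2 / c))
  have hderiv (s : ℝ) : HasDerivAt (fun s => flowIntegrand v α (flowSol v α f) x s *
      ∫ a in s..(0:ℝ), β (x + a • v))
      (flowIntegrand v α f x s * (∫ a in s..(0:ℝ), β (x + a • v)) -
        flowIntegrand v α (fun y => β y * flowSol v α f y) x s) s := by
    refine ((hasDerivAt_flowIntegrand_flowSol (v := v) hα hc hαc hf hfp x s).mul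
      (hasDerivAt_integral_orbit v hβ x s)).congr_deriv ?_
    simp only [flowIntegrand]
    ring
  have := integral_Iic_of_hasDerivAt_of_tendsto' (fun s _ => hderiv s) (hint.sub hint') htend
  rw [integral_sub hint hint', intervalIntegral.integral_same, mul_zero, sub_zero,
    sub_eq_zero] at this
  exact ⟨hint, this⟩

lemma hasFDerivAt_flowIntegrand (hα : ContDiff ℝ 1 α) (hαp : ZPeriodic α)
    (hf : ContDiff ℝ 1 f) (x : Fin n → ℝ) (s : ℝ) :
    HasFDerivAt (fun x => flowIntegrand v α f x s)
      (Real.exp (-(∫ a in s..(0:ℝ), α (x + a • v))) • fderiv ℝ f (x + s • v) -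
        flowIntegrand v α f x s • ∫ a in s..(0:ℝ), fderiv ℝ α (x + a • v)) x := by
  have h1 := (hasFDerivAt_integral_orbit v hα hαp x s).neg.exp
  have h2 := (hasFDerivAt_comp_add_right (s • v)).2
    (hf.differentiable one_ne_zero (x + s • v)).hasFDerivAt
  refine (h1.mul h2).congr_fderiv ?_
  rw [smul_smul, smul_neg, ← sub_eq_add_neg, mul_comm (f _)]
  rfl

lemma hasFDerivAt_flowSol (hα : ContDiff ℝ 1 α) (hαp : ZPeriodic α) (hc : 0 < c)
    (hαc : ∀ x, c ≤ α x) (hf : ContDiff ℝ 1 f) (hfp : ZPeriodic f) (x : Fin n → ℝ) :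
    ∃ u' : (Fin n → ℝ) →L[ℝ] ℝ, HasFDerivAt (flowSol v α f) u' x ∧ ∀ w, u' w =
      flowSol v α (fun y => fderiv ℝ f y w) x -
        flowSol v α (fun y => fderiv ℝ α y w * flowSol v α f y) x := by
  obtain ⟨C, hC⟩ := hfp.exists_bound hf.continuous
  obtain ⟨D, hD⟩ := hfp.exists_bound_fderiv hf
  obtain ⟨B, hB⟩ := hαp.exists_bound_fderiv hα
  have hα' := hα.continuous_fderiv one_ne_zero
  have hf' := hf.continuous_fderiv one_ne_zero
  set F' : (Fin n → ℝ) → ℝ → (Fin n → ℝ) →L[ℝ] ℝ := fun x s =>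
    Real.exp (-(∫ a in s..(0:ℝ), α (x + a • v))) • fderiv ℝ f (x + s • v) -
      flowIntegrand v α f x s • ∫ a in s..(0:ℝ), fderiv ℝ α (x + a • v) with hF'
  have hF'c (x : Fin n → ℝ) : Continuous (F' x) := by
    have h1 : Continuous fun s => ∫ a in s..(0:ℝ), α (x + a • v) :=
      (continuous_integral_orbit v hα.continuous).comp (.prodMk_right x)
    have h2 : Continuous fun s => ∫ a in s..(0:ℝ), fderiv ℝ α (x + a • v) :=
      (continuous_integral_orbit v hα').comp (.prodMk_right x)
    have h3 : Continuous (flowIntegrand v α f x) :=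
      (continuous_flowIntegrand hα.continuous hf.continuous).comp (.prodMk_right x)
    fun_prop
  have hbound (x : Fin n → ℝ) {s : ℝ} (hs : s ≤ 0) :
      ‖F' x s‖ ≤ D * Real.exp (c * s) + C * B * (2 / c) * Real.exp (c / 2 * s) := by
    refine (norm_sub_le _ _).trans (add_le_add ?_ ?_)
    · rw [norm_smul, Real.norm_eq_abs, Real.abs_exp, mul_comm]
      exact mul_le_mul (hD _) (exp_neg_integral_orbit_le hα.continuous hαc x hs)
        (Real.exp_pos _).le ((norm_nonneg _).trans (hD 0))
    · exact norm_flowIntegrand_smul_integral_orbit_le hα.continuous hc hαc hC hB x hs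
  have hbi : IntegrableOn
      (fun s => D * Real.exp (c * s) + C * B * (2 / c) * Real.exp (c / 2 * s)) (Set.Iic 0) :=
    ((integrableOn_exp_mul_Iic hc 0).const_mul _).add
      ((integrableOn_exp_mul_Iic (half_pos hc) 0).const_mul _)
  have hF'i : IntegrableOn (F' x) (Set.Iic 0) := hbi.mono' (hF'c x).aestronglyMeasurable <|
    (ae_restrict_mem measurableSet_Iic).mono fun s hs => hbound x hs
  refine ⟨∫ s in Set.Iic (0:ℝ), F' x s, ?_, fun w => ?_⟩
  · exact hasFDerivAt_integral_of_dominated_of_fderiv_le univ_mem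
      (.of_forall fun x => ((continuous_flowIntegrand hα.continuous hf.continuous).comp
        (.prodMk_right x)).aestronglyMeasurable)
      (integrableOn_flowIntegrand hα.continuous hc hαc hf.continuous hfp x)
      (hF'c x).aestronglyMeasurable
      ((ae_restrict_mem measurableSet_Iic).mono fun s hs y _ => hbound y hs) hbi
      (.of_forall fun s y _ => hasFDerivAt_flowIntegrand hα hαp hf y s)
  · obtain ⟨hi, he⟩ := integral_flowIntegrand_mul (v := v) hα.continuous hc hαc hαp
      hf.continuous hfp (hα'.clm_apply continuous_const) (hαp.fderiv_apply w) x
    rw [ContinuousLinearMap.integral_apply hF'i, ← he, flowSol, ← integral_sub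
      (integrableOn_flowIntegrand hα.continuous hc hαc (hf'.clm_apply continuous_const)
        (hfp.fderiv_apply w) x) hi]
    refine integral_congr_ae (.of_forall fun s => ?_)
    have h : Continuous fun a : ℝ => fderiv ℝ α (x + a • v) := by fun_prop
    simp only [hF', sub_apply, smul_apply, smul_eq_mul,
      ContinuousLinearMap.intervalIntegral_apply (h.intervalIntegrable _ _)]
    rfl

lemma contDiff_flowSol (hα : ContDiff ℝ (⊤ : ℕ∞) α) (hαp : ZPeriodic α) (hc : 0 < c)
    (hαc : ∀ x, c ≤ α x) (k : ℕ) (hf : ContDiff ℝ k f) (hfp : ZPeriodic f) :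
    ContDiff ℝ k (flowSol v α f) := by
  induction k generalizing f with
  | zero =>
    exact contDiff_zero.2 (continuous_flowSol hα.continuous hc hαc hf.continuous hfp)
  | succ k ih =>
    have hα1 : ContDiff ℝ 1 α := hα.of_le (by exact_mod_cast le_top)
    have hf1 : ContDiff ℝ 1 f := hf.of_le (by exact_mod_cast Nat.le_add_left 1 k)
    have hα' : ContDiff ℝ (k + 1) α := hα.of_le (by exact_mod_cast le_top)
    have hd := hasFDerivAt_flowSol (v := v) hα1 hαp hc hαc hf1 hfp
    push_cast at hf ⊢
    refine contDiff_succ_iff_fderiv_apply.2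
      ⟨fun x => (hd x).choose_spec.1.differentiableAt, by simp, fun w => ?_⟩
    have hw : (fun x => fderiv ℝ (flowSol v α f) x w) = fun x =>
        flowSol v α (fun y => fderiv ℝ f y w) x -
          flowSol v α (fun y => fderiv ℝ α y w * flowSol v α f y) x := funext fun x => by
      obtain ⟨u', h, hu'⟩ := hd x
      rw [h.fderiv, hu']
    rw [hw]
    exact (ih ((contDiff_succ_iff_fderiv_apply.1 hf).2.2 w) (hfp.fderiv_apply w)).sub
      (ih (((contDiff_succ_iff_fderiv_apply.1 hα').2.2 w).mul
        (ih (hf.of_le (by exact_mod_cast k.le_succ)) hfp))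
        ((hαp.fderiv_apply w).mul (hαp.flowSol hfp)))

lemma fderiv_flowSol_add_mul (hα : Continuous α) (hc : 0 < c) (hαc : ∀ x, c ≤ α x)
    (hf : Continuous f) (hfp : ZPeriodic f) (hu : Differentiable ℝ (flowSol v α f))
    (x : Fin n → ℝ) : fderiv ℝ (flowSol v α f) x v + α x * flowSol v α f x = f x := by
  have h1 := hasDerivAt_flowIntegrand_flowSol (v := v) hα hc hαc hf hfp x 0
  have hl : HasDerivAt (fun s : ℝ => x + s • v) v 0 := by
    simpa using ((hasDerivAt_id (0:ℝ)).smul_const v).const_add x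
  have h2 := (hu (x + (0:ℝ) • v)).hasFDerivAt.comp_hasDerivAt 0 hl
  have h3 := (hasDerivAt_integral_orbit v hα x 0).neg.exp.mul h2
  have := h1.unique h3
  simp [flowIntegrand] at this
  linarith

end FlowSol

/-- Surjectivity part of Lemma 6.2 on the flat torus: the explicit formula
`u(x) = ∫_{−∞}^0 exp(−∫_s^0 α(x+av) da)·f(x+sv) ds` converges absolutely,
is smooth and `ℤⁿ`-periodic, and solves `Du(x)(v) + α(x)·u(x) = f(x)`. -/
theorem stmt8 (n : ℕ) (hn : 1 ≤ n) (v : Fin n → ℝ)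
    (α : (Fin n → ℝ) → ℝ) (hα : ContDiff ℝ (⊤ : ℕ∞) α) (hαp : ZPeriodic α)
    (c : ℝ) (hc : 0 < c) (hαc : ∀ x, c ≤ α x)
    (f : (Fin n → ℝ) → ℝ) (hf : ContDiff ℝ (⊤ : ℕ∞) f) (hfp : ZPeriodic f) :
    (∀ x, IntegrableOn (flowIntegrand v α f x) (Set.Iic (0:ℝ))) ∧
    ContDiff ℝ (⊤ : ℕ∞) (flowSol v α f) ∧
    ZPeriodic (flowSol v α f) ∧
    ∀ x, fderiv ℝ (flowSol v α f) x v + α x * flowSol v α f x = f x := by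
  have hu : ContDiff ℝ (⊤ : ℕ∞) (flowSol v α f) := contDiff_infty.2 fun k =>
    contDiff_flowSol hα hαp hc hαc k (hf.of_le (by exact_mod_cast le_top)) hfp
  exact ⟨integrableOn_flowIntegrand hα.continuous hc hαc hf.continuous hfp, hu,
    hαp.flowSol hfp, fderiv_flowSol_add_mul hα.continuous hc hαc hf.continuous hfp
      (hu.differentiable (by simp))⟩
end

section
/- Define u : ℝ → ℝ by u(t) = exp(−1/t) for t > 0 and u(t) = 0 for t ≤ 0. Then u is infinitely differentiable on ℝ, it satisfies t⁴·u″(t) + 4t³·u′(t) − (2t+1)·u(t) = 0 for every t ∈ ℝ, and every iterated derivative of u vanishes at 0, i.e. u^{(n)}(0) = 0 for all n ∈ ℕ. In particular u is a nonzero solution of the equation and vanishes to infinite order at t = 0. -/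
/-- The function `exp(−1/t)` for `t > 0`, extended by `0` for `t ≤ 0`. -/
noncomputable def bump (t : ℝ) : ℝ := if 0 < t then Real.exp (-1 / t) else 0

theorem bump_eq_expNegInvGlue : bump = expNegInvGlue := by
  funext t
  by_cases h : 0 < t
  · simp [bump, expNegInvGlue, h, not_le.mpr h, neg_div]
  · simp [bump, expNegInvGlue, h, not_lt.mp h]

open Polynomial in
theorem deriv_polynomial_eval_inv_mul_expNegInvGlue (p : ℝ[X]) :
    deriv (fun x : ℝ => p.eval x⁻¹ * expNegInvGlue x) =
      fun x => (X ^ 2 * (p - derivative p)).eval x⁻¹ * expNegInvGlue x :=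
  funext fun x => (expNegInvGlue.hasDerivAt_polynomial_eval_inv_mul p x).deriv

open Polynomial in
theorem exists_iteratedDeriv_expNegInvGlue_eq (n : ℕ) :
    ∃ p : ℝ[X], iteratedDeriv n expNegInvGlue = fun x => p.eval x⁻¹ * expNegInvGlue x := by
  induction n with
  | zero => exact ⟨1, by simp⟩
  | succ n ih =>
    obtain ⟨p, hp⟩ := ih
    exact ⟨X ^ 2 * (p - derivative p), by
      rw [iteratedDeriv_succ, hp, deriv_polynomial_eval_inv_mul_expNegInvGlue]⟩

open Polynomial in
theorem deriv_expNegInvGlue :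
    deriv expNegInvGlue = fun x => (X ^ 2 : ℝ[X]).eval x⁻¹ * expNegInvGlue x := by
  simpa using deriv_polynomial_eval_inv_mul_expNegInvGlue 1

/-- Counterexample 2.5 (first part): `bump` is smooth, solves
`t⁴·u″ + 4t³·u′ − (2t+1)·u = 0` (i.e. `□u − (2t+1)u = 0` on the spacetime
`ℝ × S¹` with metric `2 dt dx + t⁴ dx²`), vanishes to infinite order at the
Cauchy horizon `t = 0`, yet is not identically zero. -/
theorem stmt18 :
    ContDiff ℝ (⊤ : ℕ∞) bump ∧
    (∀ t : ℝ, t ^ 4 * deriv (deriv bump) t + 4 * t ^ 3 * deriv bump t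
      - (2 * t + 1) * bump t = 0) ∧
    (∀ n : ℕ, iteratedDeriv n bump 0 = 0) ∧
    ∃ t : ℝ, bump t ≠ 0 := by
  rw [bump_eq_expNegInvGlue]
  refine ⟨expNegInvGlue.contDiff, fun t => ?_, fun n => ?_,
    1, (expNegInvGlue.pos_of_pos one_pos).ne'⟩
  · rw [deriv_expNegInvGlue, deriv_polynomial_eval_inv_mul_expNegInvGlue]
    rcases eq_or_ne t 0 with rfl | ht
    · simp [expNegInvGlue.zero]
    · simp
      field_simp
      ring
  · obtain ⟨p, hp⟩ := exists_iteratedDeriv_expNegInvGlue_eq n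
    simp [hp, expNegInvGlue.zero]
end
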